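/- arXiv:0706.0606 — 2 statements merged into one kernel-verified Lean document; each statement's English description precedes it below -/
import Mathlib

section
/- Let n ≥ 1 be an integer and q > n/(n+2) with q ≠ 1. For any probability density g: ℝⁿ → ℝ₊ with expectation vector u ∈ ℝⁿ and (positive definite) covariance matrix K, one has S_q(g) ≤ S_q(f_q(K⁻¹, u, ·)), with equality if and only if g = f_q(K⁻¹, u, ·) almost everywhere. -/
open MeasureTheory Matrix

/-- Normalization constant `A_{n,p}` of the `p`-Gaussian density. -/
noncomputable def gaussA (n : ℕ) (p : ℝ) : ℝ :=
  if 1 < p then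
    ((p - 1) / (2 * p - n * (1 - p))) ^ ((n : ℝ) / 2) *
      Real.Gamma (p / (p - 1) + n / 2) /
      (Real.pi ^ ((n : ℝ) / 2) * Real.Gamma (p / (p - 1)))
  else
    ((1 - p) / (2 * p - n * (1 - p))) ^ ((n : ℝ) / 2) *
      Real.Gamma (1 / (1 - p)) /
      (Real.pi ^ ((n : ℝ) / 2) * Real.Gamma (1 / (1 - p) - n / 2))

/-- The `p`-Gaussian density, `0` where the base is negative. -/
noncomputable def gaussF (n : ℕ) (p : ℝ) (D : Matrix (Fin n) (Fin n) ℝ)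
    (u x : Fin n → ℝ) : ℝ :=
  if 0 ≤ 1 + (1 - p) / (2 * p - n * (1 - p)) * ((x - u) ⬝ᵥ D.mulVec (x - u)) then
    gaussA n p * Real.sqrt D.det *
      (1 + (1 - p) / (2 * p - n * (1 - p)) * ((x - u) ⬝ᵥ D.mulVec (x - u))) ^ (1 / (p - 1))
  else 0

/-- The `q`-Rényi entropy of a density `g` on `ℝⁿ`. -/
noncomputable def renyi (n : ℕ) (q : ℝ) (g : (Fin n → ℝ) → ℝ) : ℝ :=
  1 / (1 - q) * Real.log (∫ x : Fin n → ℝ, g x ^ q)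

open Set in
/-- The Euler beta integral over the reals. -/
lemma integral_Ioo_rpow_mul_one_sub_rpow {α β : ℝ} (hα : 0 < α) (hβ : 0 < β) :
    ∫ x in Ioo (0 : ℝ) 1, x ^ (α - 1) * (1 - x) ^ (β - 1) = ProbabilityTheory.beta α β := by
  rw [ProbabilityTheory.beta_eq_betaIntegralReal α β hα hβ,
    Complex.betaIntegral, intervalIntegral.integral_of_le (by norm_num),
    ← integral_Ioc_eq_integral_Ioo, ← RCLike.re_to_complex, ← integral_re]
  · refine setIntegral_congr_fun measurableSet_Ioc fun x ⟨hx1, hx₂⟩ ↦ ?_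
    norm_cast
    rw [← Complex.ofReal_cpow, ← Complex.ofReal_cpow, RCLike.re_to_complex,
      Complex.re_mul_ofReal, Complex.ofReal_re]
    all_goals linarith
  convert! Complex.betaIntegral_convergent (u := α) (v := β) (by simpa) (by simpa)
  rw [intervalIntegrable_iff_integrableOn_Ioc_of_le (by simp), IntegrableOn]

open Set in
/-- The beta integral in its form over the half-line. -/
lemma integral_Ioi_rpow_mul_one_add_rpow {s a : ℝ} (hs : 0 < s) (hsa : s < a) :
    ∫ t in Ioi (0 : ℝ), t ^ (s - 1) * (1 + t) ^ (-a) = ProbabilityTheory.beta s (a - s) := by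
  have himage : (fun t : ℝ => t / (1 + t)) '' Ioi 0 = Ioo 0 1 := by
    ext y
    constructor
    · rintro ⟨t, ht, rfl⟩
      have ht : 0 < t := ht
      refine ⟨by positivity, ?_⟩
      rw [div_lt_one (by positivity)]
      linarith
    · rintro ⟨h0, h1⟩
      have h2 : 0 < 1 - y := by linarith
      refine ⟨y / (1 - y), div_pos h0 h2, ?_⟩
      have : 1 + y / (1 - y) = 1 / (1 - y) := by field_simp; ring
      simp only [this]
      field_simp
  have hderiv : ∀ t ∈ Ioi (0 : ℝ),
      HasDerivWithinAt (fun t : ℝ => t / (1 + t)) (1 / (1 + t) ^ 2) (Ioi 0) t := by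
    intro t ht
    have ht : 0 < t := ht
    have h := (hasDerivAt_id t).div ((hasDerivAt_id t).const_add 1) (by simp; positivity)
    refine (h.congr_deriv ?_).hasDerivWithinAt
    simp
  have hinj : InjOn (fun t : ℝ => t / (1 + t)) (Ioi 0) := by
    intro x hx y hy hxy
    have hx : 0 < x := hx
    have hy : 0 < y := hy
    have hxy : x / (1 + x) = y / (1 + y) := hxy
    rw [div_eq_div_iff (by positivity) (by positivity)] at hxy
    linarith
  rw [← integral_Ioo_rpow_mul_one_sub_rpow hs (sub_pos.2 hsa), ← himage,
    integral_image_eq_integral_abs_deriv_smul measurableSet_Ioi hderiv hinj]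
  refine setIntegral_congr_fun measurableSet_Ioi fun t ht => ?_
  have ht : 0 < t := ht
  have h1 : 0 < 1 + t := by positivity
  have h2 : 1 - t / (1 + t) = (1 + t)⁻¹ := by field_simp; ring
  simp only [smul_eq_mul, h2]
  rw [abs_of_pos (by positivity), Real.div_rpow ht.le h1.le, Real.inv_rpow h1.le,
    ← Real.rpow_neg h1.le, one_div, ← Real.rpow_natCast, ← Real.rpow_neg h1.le,
    div_eq_mul_inv, ← Real.rpow_neg h1.le]
  have h3 : -a = -((2 : ℕ) : ℝ) + -(s - 1) + -(a - s - 1) := by push_cast; ring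
  rw [h3, Real.rpow_add h1, Real.rpow_add h1]
  ring

open Set in
/-- Scaling of the Mellin transform. -/
lemma integral_Ioi_rpow_mul_comp_mul (φ : ℝ → ℝ) (s : ℝ) {d : ℝ} (hd : 0 < d) :
    ∫ t in Ioi (0 : ℝ), t ^ (s - 1) * φ (d * t) =
      d ^ (-s) * ∫ t in Ioi (0 : ℝ), t ^ (s - 1) * φ t := by
  have h := integral_comp_mul_left_Ioi (fun t => t ^ (s - 1) * φ t) 0 hd
  rw [mul_zero, smul_eq_mul] at h
  have h' : ∫ t in Ioi (0 : ℝ), (d * t) ^ (s - 1) * φ (d * t) =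
      d ^ (s - 1) * ∫ t in Ioi (0 : ℝ), t ^ (s - 1) * φ (d * t) := by
    rw [← integral_const_mul]
    refine setIntegral_congr_fun measurableSet_Ioi fun t ht => ?_
    simp only [Real.mul_rpow hd.le (le_of_lt ht), mul_assoc]
  rw [h', ← Real.rpow_neg_one d] at h
  have h2 : d ^ (-s) = d ^ (-1 : ℝ) * d ^ (-(s - 1)) := by
    rw [← Real.rpow_add hd]; congr 1; ring
  have h3 : d ^ (-(s - 1)) * d ^ (s - 1) = 1 := by
    rw [← Real.rpow_add hd]; simp
  rw [h2, mul_right_comm, ← h]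
  linear_combination (-(∫ t in Ioi (0 : ℝ), t ^ (s - 1) * φ (d * t))) * h3

open Set in
/-- Integral of a radial function on `ℝⁿ` in terms of the squared radius. -/
lemma integral_comp_dotProduct_self {n : ℕ} (hn : 1 ≤ n) (φ : ℝ → ℝ) :
    ∫ y : Fin n → ℝ, φ (y ⬝ᵥ y) =
      Real.pi ^ ((n : ℝ) / 2) / Real.Gamma (n / 2) *
        ∫ t in Ioi (0 : ℝ), t ^ ((n : ℝ) / 2 - 1) * φ t := by
  have : Nonempty (Fin n) := ⟨⟨0, hn⟩⟩
  have hn0 : (0 : ℝ) < n := by exact_mod_cast hn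
  have h1 : ∫ y : Fin n → ℝ, φ (y ⬝ᵥ y) = ∫ x : EuclideanSpace ℝ (Fin n), φ (‖x‖ ^ 2) := by
    rw [← (PiLp.volume_preserving_toLp (Fin n)).integral_comp
      (MeasurableEquiv.toLp 2 _).measurableEmbedding]
    refine integral_congr_ae (Filter.Eventually.of_forall fun y => ?_)
    simp only [EuclideanSpace.real_norm_sq_eq, dotProduct, ← sq]
  have h2 : volume.real (Metric.ball (0 : EuclideanSpace ℝ (Fin n)) 1) =
      Real.pi ^ ((n : ℝ) / 2) / Real.Gamma (n / 2 + 1) := by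
    rw [Measure.real, EuclideanSpace.volume_ball]
    have : 0 < Real.Gamma ((n : ℝ) / 2 + 1) := Real.Gamma_pos_of_pos (by positivity)
    simp only [ENNReal.ofReal_one, one_pow, one_mul, Fintype.card_fin]
    rw [ENNReal.toReal_ofReal (by positivity), Real.sqrt_eq_rpow, ← Real.rpow_natCast,
      ← Real.rpow_mul Real.pi_pos.le]
    congr 2
    ring
  have h3 : ∫ t in Ioi (0 : ℝ), t ^ ((n : ℝ) / 2 - 1) * φ t =
      2 * ∫ y in Ioi (0 : ℝ), y ^ (n - 1) • φ (y ^ 2) := by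
    rw [← integral_comp_rpow_Ioi_of_pos (p := 2) two_pos, ← integral_const_mul]
    refine setIntegral_congr_fun measurableSet_Ioi fun t ht => ?_
    have ht : 0 < t := ht
    simp only [smul_eq_mul]
    rw [← Real.rpow_mul ht.le, ← Real.rpow_natCast t (n - 1), Nat.cast_sub hn,
      show (n : ℝ) - (1 : ℕ) = (2 - 1) + 2 * (n / 2 - 1) by push_cast; ring, Real.rpow_add ht,
      Real.rpow_two]
    ring
  rw [h1, integral_fun_norm_addHaar volume (fun r => φ (r ^ 2)), h2, h3,
    finrank_euclideanSpace_fin, Real.Gamma_add_one (by positivity)]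
  have : Real.Gamma ((n : ℝ) / 2) ≠ 0 := (Real.Gamma_pos_of_pos (by positivity)).ne'
  simp only [nsmul_eq_mul, smul_eq_mul]
  field_simp

open scoped MatrixOrder Matrix.Norms.L2Operator in
lemma Matrix.PosDef.exists_isUnit_eq_star_mul_self {n : ℕ} {D : Matrix (Fin n) (Fin n) ℝ}
    (hD : D.PosDef) : ∃ B : Matrix (Fin n) (Fin n) ℝ, IsUnit B ∧ D = star B * B :=
  CStarAlgebra.isStrictlyPositive_iff_eq_star_mul_self.mp hD.isStrictlyPositive

/-- Integral of a function of a positive definite quadratic form. -/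
lemma integral_comp_quadForm {n : ℕ} {D : Matrix (Fin n) (Fin n) ℝ} (hD : D.PosDef)
    (u : Fin n → ℝ) (φ : ℝ → ℝ) :
    Real.sqrt D.det * ∫ x : Fin n → ℝ, φ ((x - u) ⬝ᵥ D.mulVec (x - u)) =
      ∫ y : Fin n → ℝ, φ (y ⬝ᵥ y) := by
  obtain ⟨B, hB, rfl⟩ := hD.exists_isUnit_eq_star_mul_self
  have hdet : B.det ≠ 0 := ((Matrix.isUnit_iff_isUnit_det B).1 hB).ne_zero
  have hemb : MeasurableEmbedding (toLin' B) := by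
    let e := LinearEquiv.ofIsUnitDet (f := toLin' B) (v := Pi.basisFun ℝ (Fin n))
      (v' := Pi.basisFun ℝ (Fin n)) (by simpa using hdet)
    exact e.toContinuousLinearEquiv.toHomeomorph.measurableEmbedding
  have hquad (x : Fin n → ℝ) : x ⬝ᵥ (star B * B).mulVec x = toLin' B x ⬝ᵥ toLin' B x := by
    rw [← mulVec_mulVec, star_eq_conjTranspose, conjTranspose_eq_transpose_of_trivial,
      dotProduct_mulVec, vecMul_transpose, toLin'_apply]
  have hmap := congrArg (fun μ => ∫ y, φ (y ⬝ᵥ y) ∂μ)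
    (Real.map_matrix_volume_pi_eq_smul_volume_pi hdet)
  simp only [hemb.integral_map, integral_smul_measure] at hmap
  rw [integral_sub_right_eq_self (fun x => φ (x ⬝ᵥ (star B * B).mulVec x)) u]
  simp only [hquad]
  rw [hmap, star_eq_conjTranspose, conjTranspose_eq_transpose_of_trivial, det_mul, det_transpose,
    Real.sqrt_mul_self_eq_abs, ENNReal.toReal_ofReal (abs_nonneg _), smul_eq_mul, abs_inv,
    mul_inv_cancel_left₀ (abs_ne_zero.2 hdet)]

/-- The radial profile of the `p`-Gaussian density, as a function of the quadratic form. -/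
noncomputable def gaussProfile (n : ℕ) (p t : ℝ) : ℝ :=
  if 0 ≤ 1 + (1 - p) / (2 * p - n * (1 - p)) * t then
    (1 + (1 - p) / (2 * p - n * (1 - p)) * t) ^ (1 / (p - 1)) else 0

lemma gaussF_eq_mul_gaussProfile (n : ℕ) (p : ℝ) (D : Matrix (Fin n) (Fin n) ℝ)
    (u x : Fin n → ℝ) :
    gaussF n p D u x =
      gaussA n p * Real.sqrt D.det * gaussProfile n p ((x - u) ⬝ᵥ D.mulVec (x - u)) := by
  unfold gaussF gaussProfile
  split_ifs <;> simp

lemma gaussProfile_denom_pos {n : ℕ} {p : ℝ} (hp : (n : ℝ) / (n + 2) < p) :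
    0 < 2 * p - n * (1 - p) := by
  rw [div_lt_iff₀ (by positivity)] at hp
  linarith

open Set ProbabilityTheory in
/-- Mellin transform of the profile in the heavy-tailed case. -/
lemma mellin_gaussProfile_of_lt_one {n : ℕ} {p s : ℝ} (hp : (n : ℝ) / (n + 2) < p) (hp1 : p < 1)
    (hs : 0 < s) (hsp : s < 1 / (1 - p)) :
    ∫ t in Ioi (0 : ℝ), t ^ (s - 1) * gaussProfile n p t =
      ((1 - p) / (2 * p - n * (1 - p))) ^ (-s) * beta s (1 / (1 - p) - s) := by
  have hδ := gaussProfile_denom_pos hp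
  have hp1' : 0 < 1 - p := by linarith
  have hc : 0 < (1 - p) / (2 * p - n * (1 - p)) := by positivity
  rw [← integral_Ioi_rpow_mul_one_add_rpow hs hsp,
    ← integral_Ioi_rpow_mul_comp_mul (fun t => (1 + t) ^ (-(1 / (1 - p)))) s hc]
  refine setIntegral_congr_fun measurableSet_Ioi fun t ht => ?_
  have ht : 0 < t := ht
  have he : 1 / (p - 1) = -(1 / (1 - p)) := by rw [← neg_sub 1 p, div_neg]
  simp only [gaussProfile, if_pos (show 0 ≤ 1 + (1 - p) / (2 * p - n * (1 - p)) * t by positivity),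
    he]

open Set ProbabilityTheory in
/-- Mellin transform of the profile in the compactly supported case. -/
lemma mellin_gaussProfile_of_one_lt {n : ℕ} {p s : ℝ} (hp : (n : ℝ) / (n + 2) < p) (hp1 : 1 < p)
    (hs : 0 < s) :
    ∫ t in Ioi (0 : ℝ), t ^ (s - 1) * gaussProfile n p t =
      ((p - 1) / (2 * p - n * (1 - p))) ^ (-s) * beta s (p / (p - 1)) := by
  have hδ := gaussProfile_denom_pos hp
  have hp1' : 0 < p - 1 := by linarith
  have hd : 0 < (p - 1) / (2 * p - n * (1 - p)) := by positivity
  have he : 0 < 1 / (p - 1) := by positivity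
  have he1 : p / (p - 1) - 1 = 1 / (p - 1) := by field_simp; ring
  have hbeta : beta s (p / (p - 1)) =
      ∫ t in Ioi (0 : ℝ), t ^ (s - 1) * if t ≤ 1 then (1 - t) ^ (1 / (p - 1)) else 0 := by
    rw [← integral_Ioo_rpow_mul_one_sub_rpow hs (by positivity : 0 < p / (p - 1)), he1,
      ← Ioi_inter_Iio, ← setIntegral_indicator measurableSet_Iio]
    refine setIntegral_congr_fun measurableSet_Ioi fun t _ => ?_
    rcases lt_trichotomy t 1 with h | rfl | h
    · simp [h, h.le]
    · simp [hp1'.ne']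
    · simp [h.not_gt, h.not_ge]
  rw [hbeta, ← integral_Ioi_rpow_mul_comp_mul _ s hd]
  refine setIntegral_congr_fun measurableSet_Ioi fun t _ => ?_
  have hc : 1 + (1 - p) / (2 * p - n * (1 - p)) * t =
      1 - (p - 1) / (2 * p - n * (1 - p)) * t := by ring
  simp only [gaussProfile, hc, sub_nonneg]

open Set ProbabilityTheory in
/-- The normalization of the profile. -/
lemma gaussA_mul_mellin_gaussProfile {n : ℕ} (hn : 1 ≤ n) {p : ℝ} (hp : (n : ℝ) / (n + 2) < p)
    (hp1 : p ≠ 1) :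
    gaussA n p * (Real.pi ^ ((n : ℝ) / 2) / Real.Gamma (n / 2) *
      ∫ t in Ioi (0 : ℝ), t ^ ((n : ℝ) / 2 - 1) * gaussProfile n p t) = 1 := by
  have hδ := gaussProfile_denom_pos hp
  have hn0 : (0 : ℝ) < n := by exact_mod_cast hn
  have hpi : Real.pi ^ ((n : ℝ) / 2) ≠ 0 := (Real.rpow_pos_of_pos Real.pi_pos _).ne'
  have hΓ : Real.Gamma ((n : ℝ) / 2) ≠ 0 := (Real.Gamma_pos_of_pos (by positivity)).ne'
  rcases hp1.lt_or_gt with h | h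
  · have h' : 0 < 1 - p := by linarith
    have hlt : (n : ℝ) / 2 < 1 / (1 - p) := by
      rw [div_lt_div_iff₀ two_pos h']; nlinarith
    have hc : 0 < (1 - p) / (2 * p - n * (1 - p)) := by positivity
    have hΓ1 := (Real.Gamma_pos_of_pos (sub_pos.2 hlt)).ne'
    have hΓ2 := (Real.Gamma_pos_of_pos (one_div_pos.2 h')).ne'
    have hcs := (Real.rpow_pos_of_pos hc ((n : ℝ) / 2)).ne'
    rw [mellin_gaussProfile_of_lt_one hp h (by positivity) hlt, gaussA, if_neg h.not_gt, beta,
      add_sub_cancel, Real.rpow_neg hc.le]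
    generalize ((1 - p) / (2 * p - n * (1 - p))) ^ ((n : ℝ) / 2) = X at *
    generalize Real.Gamma (1 / (1 - p) - n / 2) = Y at *
    generalize Real.Gamma (1 / (1 - p)) = Z at *
    field_simp
  · have h' : 0 < p - 1 := by linarith
    have hd : 0 < (p - 1) / (2 * p - n * (1 - p)) := by positivity
    have hΓ1 := (Real.Gamma_pos_of_pos (by positivity : 0 < p / (p - 1))).ne'
    have hΓ2 := (Real.Gamma_pos_of_pos (by positivity : 0 < p / (p - 1) + n / 2)).ne'
    have hcs := (Real.rpow_pos_of_pos hd ((n : ℝ) / 2)).ne'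
    rw [mellin_gaussProfile_of_one_lt hp h (by positivity), gaussA, if_pos h, beta,
      add_comm ((n : ℝ) / 2), Real.rpow_neg hd.le]
    generalize ((p - 1) / (2 * p - n * (1 - p))) ^ ((n : ℝ) / 2) = X at *
    generalize Real.Gamma (p / (p - 1) + n / 2) = Y at *
    generalize Real.Gamma (p / (p - 1)) = Z at *
    field_simp

open Set ProbabilityTheory in
/-- The second moment of the profile. -/
lemma mellin_gaussProfile_succ {n : ℕ} (hn : 1 ≤ n) {p : ℝ} (hp : (n : ℝ) / (n + 2) < p)
    (hp1 : p ≠ 1) :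
    ∫ t in Ioi (0 : ℝ), t ^ ((n : ℝ) / 2 - 1) * (t * gaussProfile n p t) =
      n * ∫ t in Ioi (0 : ℝ), t ^ ((n : ℝ) / 2 - 1) * gaussProfile n p t := by
  have hδ := gaussProfile_denom_pos hp
  have hn0 : (0 : ℝ) < n := by exact_mod_cast hn
  have hshift : ∫ t in Ioi (0 : ℝ), t ^ ((n : ℝ) / 2 - 1) * (t * gaussProfile n p t) =
      ∫ t in Ioi (0 : ℝ), t ^ ((n : ℝ) / 2 + 1 - 1) * gaussProfile n p t := by
    refine setIntegral_congr_fun measurableSet_Ioi fun t ht => ?_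
    have ht : 0 < t := ht
    simp only [add_sub_right_comm, Real.rpow_add_one ht.ne', mul_assoc]
  rw [hshift]
  rcases hp1.lt_or_gt with h | h
  · have h' : 0 < 1 - p := by linarith
    have hlt : (n : ℝ) / 2 + 1 < 1 / (1 - p) := by
      rw [lt_div_iff₀ h']; nlinarith
    have hc : 0 < (1 - p) / (2 * p - n * (1 - p)) := by positivity
    have hΓ : Real.Gamma (1 / (1 - p) - n / 2) =
        (1 / (1 - p) - (n / 2 + 1)) * Real.Gamma (1 / (1 - p) - (n / 2 + 1)) := by
      rw [← Real.Gamma_add_one (sub_pos.2 hlt).ne']; congr 1; ring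
    have hval : n / 2 * ((1 - p) / (2 * p - n * (1 - p)))⁻¹ =
        n * (1 / (1 - p) - ((n : ℝ) / 2 + 1)) := by
      field_simp; ring
    rw [mellin_gaussProfile_of_lt_one hp h (by positivity) hlt,
      mellin_gaussProfile_of_lt_one hp h (by positivity) (by linarith), beta, beta,
      add_sub_cancel, add_sub_cancel, hΓ, Real.Gamma_add_one (by positivity), neg_add,
      Real.rpow_add hc, Real.rpow_neg_one]
    linear_combination ((1 - p) / (2 * p - n * (1 - p))) ^ (-((n : ℝ) / 2)) *
      (Real.Gamma (n / 2) * Real.Gamma (1 / (1 - p) - (n / 2 + 1)) / Real.Gamma (1 / (1 - p))) *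
      hval
  · have h' : 0 < p - 1 := by linarith
    have hd : 0 < (p - 1) / (2 * p - n * (1 - p)) := by positivity
    have hpos : 0 < (n : ℝ) / 2 + p / (p - 1) := by positivity
    have hval : n / 2 * ((p - 1) / (2 * p - n * (1 - p)))⁻¹ / (n / 2 + p / (p - 1)) = n := by
      rw [div_eq_iff hpos.ne']
      field_simp; ring
    rw [mellin_gaussProfile_of_one_lt hp h (by positivity),
      mellin_gaussProfile_of_one_lt hp h (by positivity), beta, beta,
      Real.Gamma_add_one (by positivity), add_right_comm, Real.Gamma_add_one hpos.ne', neg_add,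
      Real.rpow_add hd, Real.rpow_neg_one]
    have hΓ := (Real.Gamma_pos_of_pos hpos).ne'
    generalize ((p - 1) / (2 * p - n * (1 - p))) ^ (-((n : ℝ) / 2)) = X at *
    calc _ = (n / 2 * ((p - 1) / (2 * p - n * (1 - p)))⁻¹ / (n / 2 + p / (p - 1))) *
          (X * (Real.Gamma (n / 2) * Real.Gamma (p / (p - 1)) /
            Real.Gamma (n / 2 + p / (p - 1)))) := by
          generalize Real.Gamma (n / 2 + p / (p - 1)) = Y at *
          generalize (n : ℝ) / 2 + p / (p - 1) = Z at *
          field_simp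
      _ = _ := by rw [hval]

section Moments

variable {n : ℕ} {p : ℝ} {D : Matrix (Fin n) (Fin n) ℝ}

theorem integral_gaussF (hn : 1 ≤ n) (hp : (n : ℝ) / (n + 2) < p) (hp1 : p ≠ 1)
    (hD : D.PosDef) (u : Fin n → ℝ) : ∫ x, gaussF n p D u x = 1 := by
  simp only [gaussF_eq_mul_gaussProfile]
  rw [integral_const_mul, mul_assoc, integral_comp_quadForm hD, integral_comp_dotProduct_self hn,
    gaussA_mul_mellin_gaussProfile hn hp hp1]

theorem integral_quadForm_mul_gaussF (hn : 1 ≤ n) (hp : (n : ℝ) / (n + 2) < p) (hp1 : p ≠ 1)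
    (hD : D.PosDef) (u : Fin n → ℝ) :
    ∫ x, (x - u) ⬝ᵥ D.mulVec (x - u) * gaussF n p D u x = n := by
  simp only [gaussF_eq_mul_gaussProfile, mul_left_comm _ (gaussA n p * Real.sqrt D.det)]
  rw [integral_const_mul, mul_assoc,
    integral_comp_quadForm hD u (fun t => t * gaussProfile n p t),
    integral_comp_dotProduct_self hn (fun t => t * gaussProfile n p t),
    mellin_gaussProfile_succ hn hp hp1]
  linear_combination (n : ℝ) * gaussA_mul_mellin_gaussProfile hn hp hp1

lemma integrable_gaussF (hn : 1 ≤ n) (hp : (n : ℝ) / (n + 2) < p) (hp1 : p ≠ 1)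
    (hD : D.PosDef) (u : Fin n → ℝ) : Integrable (gaussF n p D u) :=
  Integrable.of_integral_ne_zero (by simp [integral_gaussF hn hp hp1 hD u])

lemma integrable_quadForm_mul_gaussF (hn : 1 ≤ n) (hp : (n : ℝ) / (n + 2) < p) (hp1 : p ≠ 1)
    (hD : D.PosDef) (u : Fin n → ℝ) :
    Integrable fun x => (x - u) ⬝ᵥ D.mulVec (x - u) * gaussF n p D u x :=
  Integrable.of_integral_ne_zero (by
    rw [integral_quadForm_mul_gaussF hn hp hp1 hD u]
    exact_mod_cast (by lia : n ≠ 0))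

end Moments

lemma gaussProfile_nonneg (n : ℕ) (p t : ℝ) : 0 ≤ gaussProfile n p t := by
  unfold gaussProfile
  split_ifs with h
  exacts [Real.rpow_nonneg h _, le_rfl]

lemma gaussA_pos {n : ℕ} (hn : 1 ≤ n) {p : ℝ} (hp : (n : ℝ) / (n + 2) < p) (hp1 : p ≠ 1) :
    0 < gaussA n p := by
  refine pos_of_mul_pos_left ((gaussA_mul_mellin_gaussProfile hn hp hp1).symm ▸ one_pos) ?_
  have : 0 ≤ Real.Gamma ((n : ℝ) / 2) := Real.Gamma_nonneg_of_nonneg (by positivity)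
  have : 0 ≤ ∫ t in Set.Ioi (0 : ℝ), t ^ ((n : ℝ) / 2 - 1) * gaussProfile n p t :=
    setIntegral_nonneg measurableSet_Ioi fun t ht =>
      mul_nonneg (Real.rpow_nonneg (le_of_lt ht) _) (gaussProfile_nonneg n p t)
  positivity

/-- On its support the `p`-Gaussian has an affine `(p-1)`-th power; off its support the affine
function is nonpositive, which only happens for `1 < p`. -/
lemma gaussF_rpow_sub_one {n : ℕ} (hn : 1 ≤ n) {p : ℝ} (hp : (n : ℝ) / (n + 2) < p) (hp1 : p ≠ 1)
    {D : Matrix (Fin n) (Fin n) ℝ} (hD : D.PosDef) (u x : Fin n → ℝ) :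
    (0 < gaussF n p D u x ∧
      (gaussA n p * Real.sqrt D.det) ^ (p - 1) *
        (1 + (1 - p) / (2 * p - n * (1 - p)) * ((x - u) ⬝ᵥ D.mulVec (x - u))) =
          gaussF n p D u x ^ (p - 1)) ∨
    (gaussF n p D u x = 0 ∧ 1 < p ∧ (gaussA n p * Real.sqrt D.det) ^ (p - 1) *
        (1 + (1 - p) / (2 * p - n * (1 - p)) * ((x - u) ⬝ᵥ D.mulVec (x - u))) ≤ 0) := by
  have hδ := gaussProfile_denom_pos hp
  have hA := gaussA_pos hn hp hp1
  have hC : 0 < gaussA n p * Real.sqrt D.det := mul_pos hA (Real.sqrt_pos.2 hD.det_pos)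
  have hW : 0 ≤ (x - u) ⬝ᵥ D.mulVec (x - u) := by
    simpa using hD.posSemidef.dotProduct_mulVec_nonneg (x - u)
  have hp1' : p - 1 ≠ 0 := sub_ne_zero.2 hp1
  unfold gaussF
  generalize (x - u) ⬝ᵥ D.mulVec (x - u) = W at *
  generalize gaussA n p * Real.sqrt D.det = C at *
  rcases lt_or_ge 0 (1 + (1 - p) / (2 * p - n * (1 - p)) * W) with hB | hB
  · left
    rw [if_pos hB.le]
    refine ⟨mul_pos hC (Real.rpow_pos_of_pos hB _), ?_⟩
    rw [Real.mul_rpow hC.le (Real.rpow_nonneg hB.le _), ← Real.rpow_mul hB.le,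
      one_div_mul_cancel hp1', Real.rpow_one]
  · right
    have hlt : 1 < p := by
      by_contra hle
      have : 0 ≤ 1 - p := by linarith
      have : 0 ≤ (1 - p) / (2 * p - n * (1 - p)) * W := by positivity
      linarith
    refine ⟨?_, hlt, mul_nonpos_of_nonneg_of_nonpos (Real.rpow_nonneg hC.le _) hB⟩
    split_ifs with h
    · rw [le_antisymm hB h, Real.zero_rpow (one_div_ne_zero hp1'), mul_zero]
    · rfl

/-- The strict Bernoulli inequality for `x ↦ x ^ q`, in a form uniform in `q`. -/
lemma bregman_rpow_pos {q a b : ℝ} (hq : 0 < q) (hq1 : q ≠ 1) (ha : 0 ≤ a) (hb : 0 < b)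
    (hab : a ≠ b) :
    0 < (1 - q) * ((1 - q) * b ^ q + q * b ^ (q - 1) * a - a ^ q) := by
  have hs : -1 ≤ a / b - 1 := by
    have : 0 ≤ a / b := by positivity
    linarith
  have hs0 : a / b - 1 ≠ 0 := fun h => hab (by field_simp at h; linarith)
  have hbq : 0 < b ^ q := Real.rpow_pos_of_pos hb q
  have hmain : (1 - q) * b ^ q + q * b ^ (q - 1) * a - a ^ q =
      b ^ q * (1 + q * (a / b - 1) - (1 + (a / b - 1)) ^ q) := by
    rw [add_sub_cancel, Real.div_rpow ha hb.le, Real.rpow_sub_one hb.ne']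
    field_simp
    ring
  rw [hmain]
  rcases hq1.lt_or_gt with h | h
  · have := rpow_one_add_lt_one_add_mul_self hs hs0 hq h
    exact mul_pos (by linarith) (mul_pos hbq (by linarith))
  · have := one_add_mul_self_lt_rpow_one_add hs hs0 h
    exact mul_pos_of_neg_of_neg (by linarith) (mul_neg_of_pos_of_neg hbq (by linarith))

/-- Integral of the inverse covariance form against a density with covariance `K`. -/
lemma integral_quadForm_inv_mul {n : ℕ} {g : (Fin n → ℝ) → ℝ} {u : Fin n → ℝ}
    {K : Matrix (Fin n) (Fin n) ℝ} (hK : K.PosDef)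
    (hci : ∀ i j, Integrable fun x : Fin n → ℝ => (x i - u i) * (x j - u j) * g x)
    (hcov : ∀ i j, ∫ x : Fin n → ℝ, (x i - u i) * (x j - u j) * g x = K i j) :
    Integrable (fun x : Fin n → ℝ => (x - u) ⬝ᵥ K⁻¹.mulVec (x - u) * g x) ∧
      ∫ x : Fin n → ℝ, (x - u) ⬝ᵥ K⁻¹.mulVec (x - u) * g x = n := by
  have hsum (x : Fin n → ℝ) : (x - u) ⬝ᵥ K⁻¹.mulVec (x - u) * g x =
      ∑ i, ∑ j, K⁻¹ i j * ((x i - u i) * (x j - u j) * g x) := by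
    simp only [dotProduct, mulVec, Finset.sum_mul, Finset.mul_sum, Pi.sub_apply]
    exact Finset.sum_congr rfl fun i _ => Finset.sum_congr rfl fun j _ => by ring
  simp only [hsum]
  have hint (i j : Fin n) := (hci i j).const_mul (K⁻¹ i j)
  refine ⟨integrable_finsetSum _ fun i _ => integrable_finsetSum _ fun j _ => hint i j, ?_⟩
  rw [integral_finsetSum _ fun i _ => integrable_finsetSum _ fun j _ => hint i j]
  simp only [integral_finsetSum _ fun j _ => hint _ j, integral_const_mul, hcov]
  have htrace : (K⁻¹ * K).trace = n := by
    rw [nonsing_inv_mul _ (isUnit_iff_ne_zero.2 hK.det_pos.ne'), trace_one, Fintype.card_fin]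
  have hsymm (i j : Fin n) : K j i = K i j := by simpa using hK.isHermitian.apply i j
  simpa [trace, mul_apply, hsymm] using htrace

/-- among probability densities `g` with expectation `u` and positive
definite covariance `K`, the `q`-Gaussian `f_q(K⁻¹,u,·)` maximizes the `q`-Rényi entropy,
with equality iff `g = f_q(K⁻¹,u,·)` almost everywhere. -/
theorem renyi_le_renyi_gaussF (n : ℕ) (hn : 1 ≤ n) (q : ℝ)
    (hq : (n : ℝ) / (n + 2) < q) (hq1 : q ≠ 1)
    (g : (Fin n → ℝ) → ℝ) (u : Fin n → ℝ)
    (K : Matrix (Fin n) (Fin n) ℝ) (hK : K.PosDef)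
    (hg0 : ∀ x, 0 ≤ g x) (hgi : Integrable g) (hg1 : ∫ x : Fin n → ℝ, g x = 1)
    (hmi : ∀ i, Integrable fun x : Fin n → ℝ => x i * g x)
    (hmean : ∀ i, ∫ x : Fin n → ℝ, x i * g x = u i)
    (hci : ∀ i j, Integrable fun x : Fin n → ℝ => (x i - u i) * (x j - u j) * g x)
    (hcov : ∀ i j, ∫ x : Fin n → ℝ, (x i - u i) * (x j - u j) * g x = K i j)
    (hgq : Integrable fun x : Fin n → ℝ => g x ^ q) :
    renyi n q g ≤ renyi n q (gaussF n q K⁻¹ u) ∧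
      (renyi n q g = renyi n q (gaussF n q K⁻¹ u) ↔ g =ᵐ[volume] gaussF n q K⁻¹ u) := by
  have hq0 : 0 < q := lt_of_le_of_lt (by positivity) hq
  have hδ := gaussProfile_denom_pos hq
  have hD : K⁻¹.PosDef := hK.inv
  have hC : 0 < gaussA n q * Real.sqrt K⁻¹.det :=
    mul_pos (gaussA_pos hn hq hq1) (Real.sqrt_pos.2 hD.det_pos)
  have hf := gaussF_rpow_sub_one hn hq hq1 hD u
  have hfi := integrable_gaussF hn hq hq1 hD u
  have hfQi := integrable_quadForm_mul_gaussF hn hq hq1 hD u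
  have hf1 := integral_gaussF hn hq hq1 hD u
  have hfQ := integral_quadForm_mul_gaussF hn hq hq1 hD u
  obtain ⟨hgQi, hgQ⟩ := integral_quadForm_inv_mul hK hci hcov
  set f := gaussF n q K⁻¹ u
  set L := (gaussA n q * Real.sqrt K⁻¹.det) ^ (q - 1)
  set c := (1 - q) / (2 * q - n * (1 - q)) with hc
  have hL0 : 0 < L := Real.rpow_pos_of_pos hC _
  have haffine {h : (Fin n → ℝ) → ℝ} (hi : Integrable h) (h1 : ∫ x, h x = 1)
      (hQi : Integrable fun x => (x - u) ⬝ᵥ K⁻¹.mulVec (x - u) * h x)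
      (hQ : ∫ x, (x - u) ⬝ᵥ K⁻¹.mulVec (x - u) * h x = n) :
      Integrable (fun x => L * (1 + c * ((x - u) ⬝ᵥ K⁻¹.mulVec (x - u))) * h x) ∧
        ∫ x, L * (1 + c * ((x - u) ⬝ᵥ K⁻¹.mulVec (x - u))) * h x = L * (1 + c * n) := by
    have heq (x : Fin n → ℝ) : L * (1 + c * ((x - u) ⬝ᵥ K⁻¹.mulVec (x - u))) * h x =
        L * h x + L * c * ((x - u) ⬝ᵥ K⁻¹.mulVec (x - u) * h x) := by ring
    simp only [heq]
    refine ⟨(hi.const_mul _).add (hQi.const_mul _), ?_⟩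
    rw [integral_add (hi.const_mul _) (hQi.const_mul _), integral_const_mul, integral_const_mul,
      h1, hQ]
    ring
  obtain ⟨hfLi, hfL⟩ := haffine hfi hf1 hfQi hfQ
  obtain ⟨hgLi, hgL⟩ := haffine hgi hg1 hgQi hgQ
  have hfpow (x : Fin n → ℝ) :
      L * (1 + c * ((x - u) ⬝ᵥ K⁻¹.mulVec (x - u))) * f x = f x ^ q := by
    rcases hf x with ⟨hpos, h⟩ | ⟨h0, -, -⟩
    · rw [h, Real.rpow_sub_one hpos.ne', div_mul_cancel₀ _ hpos.ne']
    · rw [h0, mul_zero, Real.zero_rpow hq0.ne']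
  simp only [hfpow] at hfLi hfL
  let F (x : Fin n → ℝ) : ℝ := (1 - q) * ((1 - q) * f x ^ q +
    q * (L * (1 + c * ((x - u) ⬝ᵥ K⁻¹.mulVec (x - u))) * g x) - g x ^ q)
  have hFne (x : Fin n → ℝ) (hx : g x ≠ f x) : 0 < F x := by
    rcases hf x with ⟨hpos, h⟩ | ⟨h0, hlt, h⟩
    · have := bregman_rpow_pos hq0 hq1 (hg0 x) hpos hx
      rw [← h] at this
      simpa only [F, mul_assoc] using this
    · have hgx : 0 < g x := (hg0 x).lt_of_ne (by rw [← h0]; exact hx.symm)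
      have h1 : 0 < g x ^ q := Real.rpow_pos_of_pos hgx q
      have h2 := mul_nonpos_of_nonneg_of_nonpos hq0.le (mul_nonpos_of_nonpos_of_nonneg h hgx.le)
      simp only [F, h0, Real.zero_rpow hq0.ne', mul_zero, zero_add]
      exact mul_pos_of_neg_of_neg (by linarith) (by linarith)
  have hFeq (x : Fin n → ℝ) (hx : g x = f x) : F x = 0 := by
    simp only [F, hx, hfpow]
    ring
  have hF0 (x : Fin n → ℝ) : 0 ≤ F x := by
    by_cases hx : g x = f x
    exacts [(hFeq x hx).ge, (hFne x hx).le]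
  have hFi : Integrable F :=
    (((hfLi.const_mul (1 - q)).add (hgLi.const_mul q)).sub hgq).const_mul (1 - q)
  have hFint : ∫ x, F x = (1 - q) * ((∫ x, f x ^ q) - ∫ x, g x ^ q) := by
    have hadd : Integrable fun x => (1 - q) * f x ^ q +
        q * (L * (1 + c * ((x - u) ⬝ᵥ K⁻¹.mulVec (x - u))) * g x) :=
      (hfLi.const_mul _).add (hgLi.const_mul _)
    simp only [F]
    rw [integral_const_mul, integral_sub hadd hgq,
      integral_add (hfLi.const_mul _) (hgLi.const_mul _), integral_const_mul, integral_const_mul,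
      hgL, hfL]
    ring
  have hFzero : ∫ x, F x = 0 ↔ g =ᵐ[volume] f := by
    rw [integral_eq_zero_iff_of_nonneg hF0 hFi]
    refine Filter.eventually_congr (Filter.Eventually.of_forall fun x => ?_)
    exact ⟨fun h => by_contra fun hx => (hFne x hx).ne' h, hFeq x⟩
  have hfq_pos : 0 < ∫ x, f x ^ q := by
    have : 1 + c * n = 2 * q / (2 * q - n * (1 - q)) := by
      rw [eq_div_iff hδ.ne', hc]
      linear_combination (n : ℝ) * div_mul_cancel₀ (1 - q) hδ.ne'
    rw [hfL, this]
    positivity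
  have hgq_pos : 0 < ∫ x, g x ^ q := by
    refine (integral_nonneg fun x => Real.rpow_nonneg (hg0 x) q).lt_of_ne' fun h => ?_
    rw [integral_eq_zero_iff_of_nonneg (fun x => Real.rpow_nonneg (hg0 x) q) hgq] at h
    have hg : g =ᵐ[volume] 0 := by
      filter_upwards [h] with x hx
      exact ((Real.rpow_eq_zero_iff_of_nonneg (hg0 x)).1 hx).1
    simp [integral_congr_ae hg] at hg1
  have hF_nonneg : 0 ≤ (1 - q) * ((∫ x, f x ^ q) - ∫ x, g x ^ q) :=
    hFint ▸ integral_nonneg hF0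
  unfold renyi
  constructor
  · rcases hq1.lt_or_gt with h | h
    · have h' : 0 < 1 - q := by linarith
      have := nonneg_of_mul_nonneg_right hF_nonneg h'
      exact mul_le_mul_of_nonneg_left (Real.log_le_log hgq_pos (by linarith)) (by positivity)
    · have h' : 1 - q < 0 := by linarith
      have := nonpos_of_mul_nonneg_right hF_nonneg h'
      exact mul_le_mul_of_nonpos_left (Real.log_le_log hfq_pos (by linarith))
        (one_div_neg.2 h').le
  · have h' : 1 - q ≠ 0 := sub_ne_zero.2 hq1.symm
    rw [← hFzero, hFint, mul_right_inj' (one_div_ne_zero h'),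
      Real.log_injOn_pos.eq_iff hgq_pos hfq_pos, mul_eq_zero, or_iff_right h', sub_eq_zero,
      eq_comm]
end

section
/- Let n ≥ 1 be an integer and n/(n+2) < p < 2 with p ≠ 1. For every D ∈ 𝓜ₙ, u ∈ ℝⁿ, every pair of n×n real symmetric matrices X, Y and vectors x, y ∈ ℝⁿ, the Fisher information ∫_{ℝⁿ} f_p(D,u,z) · (d/dt log f_p(D+tX, u+tx, z))|_{t=0} · (d/ds log f_p(D+sY, u+sy, z))|_{s=0} dz equals (1/(2(2−p)))·Tr(D⁻¹XD⁻¹Y) + ((p−1)/(4(2−p)))·Tr(D⁻¹X)·Tr(D⁻¹Y) + ((2+n(p−1))/((2p+n(p−1))(2−p)))·⟨x, Dy⟩. -/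
open MeasureTheory Matrix

/-- The beta integral over the open unit interval. -/
lemma integrableOn_and_integral_beta {x y : ℝ} (hx : 0 < x) (hy : 0 < y) :
    IntegrableOn (fun t : ℝ => t ^ (x - 1) * (1 - t) ^ (y - 1)) (Set.Ioo 0 1) ∧
      ∫ t in Set.Ioo (0 : ℝ) 1, t ^ (x - 1) * (1 - t) ^ (y - 1) =
        ProbabilityTheory.beta x y := by
  have hB := ProbabilityTheory.beta_pos hx hy
  have hnn : 0 ≤ᵐ[volume] ProbabilityTheory.betaPDFReal x y := by
    refine Filter.Eventually.of_forall fun t => ?_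
    by_cases ht : 0 < t ∧ t < 1
    · exact (ProbabilityTheory.betaPDFReal_pos ht.1 ht.2 hx hy).le
    · simp [ProbabilityTheory.betaPDFReal, ht]
  have hm := (ProbabilityTheory.stronglyMeasurable_betaPDFReal x y).aestronglyMeasurable
    (μ := volume)
  have hl := ProbabilityTheory.lintegral_betaPDF_eq_one hx hy
  have heq : (Set.Ioo (0 : ℝ) 1).indicator (fun t : ℝ => t ^ (x - 1) * (1 - t) ^ (y - 1)) =
      fun t => ProbabilityTheory.beta x y * ProbabilityTheory.betaPDFReal x y t := by
    ext t
    by_cases ht : 0 < t ∧ t < 1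
    · simp [ProbabilityTheory.betaPDFReal, ht]
      field_simp
    · simp [ProbabilityTheory.betaPDFReal, ht, Set.indicator]
  have hint : Integrable (ProbabilityTheory.betaPDFReal x y) := by
    refine ⟨hm, (hasFiniteIntegral_iff_ofReal hnn).2 ?_⟩
    simp only [ProbabilityTheory.betaPDF] at hl
    simp [hl]
  constructor
  · rw [← integrable_indicator_iff measurableSet_Ioo, heq]
    exact hint.const_mul _
  · rw [← integral_indicator measurableSet_Ioo, heq, integral_const_mul,
      integral_eq_lintegral_of_nonneg_ae hnn hm]
    simp only [ProbabilityTheory.betaPDF] at hl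
    simp [hl]

/-- The truncated power `(1 + β r²)₊ ^ e`, set to `0` where the base is not positive. -/
noncomputable def truncPow (β e r : ℝ) : ℝ :=
  if 0 < 1 + β * r ^ 2 then (1 + β * r ^ 2) ^ e else 0

lemma measurable_truncPow (β e : ℝ) : Measurable (truncPow β e) := by
  unfold truncPow
  refine Measurable.ite (measurableSet_lt measurable_const (by fun_prop)) ?_ measurable_const
  fun_prop

lemma rpow_radial_exponent {b r : ℝ} (hb : 0 < b) (hr : 0 < r) (m : ℕ) :
    2 * b * r * (b * r ^ 2) ^ (((m : ℝ) + 1) / 2 - 1) = 2 * b ^ (((m : ℝ) + 1) / 2) * r ^ m := by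
  rw [Real.mul_rpow hb.le (by positivity), ← Real.rpow_natCast r 2, ← Real.rpow_mul hr.le,
    Real.rpow_sub_one hb.ne', ← Real.rpow_natCast r m]
  have : (r : ℝ) ^ (m : ℝ) = r ^ (((2 : ℕ) : ℝ) * (((m : ℝ) + 1) / 2 - 1)) * r := by
    rw [← Real.rpow_add_one hr.ne']
    congr 1
    push_cast
    ring
  rw [this]
  field_simp

/-- Radial moments of a truncated power with bounded support. -/
lemma integrableOn_and_integral_truncPow_neg {b e : ℝ} (hb : 0 < b) (he : 0 < e + 1) (m : ℕ) :
    IntegrableOn (fun r : ℝ => r ^ m * truncPow (-b) e r) (Set.Ioi 0) ∧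
      ∫ r in Set.Ioi (0 : ℝ), r ^ m * truncPow (-b) e r =
        b ^ (-(((m : ℝ) + 1) / 2)) / 2 * ProbabilityTheory.beta (((m : ℝ) + 1) / 2) (e + 1) := by
  set x : ℝ := ((m : ℝ) + 1) / 2 with hx
  have hx0 : 0 < x := by positivity
  obtain ⟨hI, hV⟩ := integrableOn_and_integral_beta hx0 he
  set S : Set ℝ := {r | 0 < r ∧ b * r ^ 2 < 1} with hS
  have hSm : MeasurableSet S :=
    (measurableSet_lt measurable_const measurable_id).inter
      (measurableSet_lt (f := fun r : ℝ => b * r ^ 2) (by fun_prop) measurable_const)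
  have himg : Set.image (fun r : ℝ => b * r ^ 2) S = Set.Ioo 0 1 := by
    ext t
    constructor
    · rintro ⟨r, ⟨hr, hr1⟩, rfl⟩
      exact ⟨by positivity, hr1⟩
    · rintro ⟨h0, h1⟩
      have hsq : b * √(t / b) ^ 2 = t := by
        rw [Real.sq_sqrt (by positivity)]
        field_simp
      exact ⟨√(t / b), ⟨by positivity, by rw [hsq]; exact h1⟩, hsq⟩
  have hderiv : ∀ r ∈ S, HasDerivWithinAt (fun r : ℝ => b * r ^ 2) (2 * b * r) S r := fun r _ =>
    ((hasDerivAt_pow 2 r).const_mul b |>.congr_deriv (by push_cast; ring)).hasDerivWithinAt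
  have hinj : Set.InjOn (fun r : ℝ => b * r ^ 2) S := fun r hr s hs h => by
    have h2 : r ^ 2 = s ^ 2 := mul_left_cancel₀ hb.ne' h
    exact (pow_left_inj₀ hr.1.le hs.1.le two_ne_zero).1 h2
  have hc1 := integrableOn_image_iff_integrableOn_abs_deriv_smul hSm hderiv hinj
    (fun t : ℝ => t ^ (x - 1) * (1 - t) ^ (e + 1 - 1))
  have hc2 := integral_image_eq_integral_abs_deriv_smul hSm hderiv hinj
    (fun t : ℝ => t ^ (x - 1) * (1 - t) ^ (e + 1 - 1))
  have hEq : Set.EqOn (fun r : ℝ => |2 * b * r| • ((b * r ^ 2) ^ (x - 1) *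
      (1 - b * r ^ 2) ^ (e + 1 - 1))) (fun r => 2 * b ^ x * (r ^ m * truncPow (-b) e r)) S := by
    rintro r ⟨hr, hr1⟩
    have := rpow_radial_exponent hb hr m
    have hpos : 0 < 1 + -b * r ^ 2 := by linarith
    simp only [smul_eq_mul, truncPow, if_pos hpos, abs_of_pos (by positivity : 0 < 2 * b * r),
      add_sub_cancel_right]
    rw [← mul_assoc, hx, this, neg_mul, ← sub_eq_add_neg, mul_assoc]
  rw [himg] at hc1 hc2
  rw [integrableOn_congr_fun hEq hSm] at hc1
  rw [setIntegral_congr_fun hSm hEq, hV, integral_const_mul] at hc2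
  have hbx : 0 < b ^ x := by positivity
  have hind : (Set.Ioi (0 : ℝ)).indicator (fun r : ℝ => r ^ m * truncPow (-b) e r) =
      S.indicator (fun r : ℝ => r ^ m * truncPow (-b) e r) := by
    ext r
    by_cases hr : 0 < r
    · by_cases hr1 : b * r ^ 2 < 1
      · simp [Set.indicator, hS, hr, hr1]
      · have : ¬ 0 < 1 + -b * r ^ 2 := by linarith
        simp [Set.indicator, hS, hr, hr1, truncPow]
    · simp [Set.indicator, hS, hr]
  constructor
  · rw [← integrable_indicator_iff measurableSet_Ioi, hind, integrable_indicator_iff hSm]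
    have := (hc1.1 hI).const_mul (2 * b ^ x)⁻¹
    refine this.congr (Filter.Eventually.of_forall fun r => ?_)
    simp only []
    field_simp
  · rw [← integral_indicator measurableSet_Ioi, hind, integral_indicator hSm, hc2,
      Real.rpow_neg hb.le]
    field_simp

/-- Radial moments of a decaying power of `1 + b r²`. -/
lemma integrableOn_and_integral_truncPow_pos {b s : ℝ} (hb : 0 < b) (m : ℕ)
    (hs : ((m : ℝ) + 1) / 2 < s) :
    IntegrableOn (fun r : ℝ => r ^ m * truncPow b (-s) r) (Set.Ioi 0) ∧
      ∫ r in Set.Ioi (0 : ℝ), r ^ m * truncPow b (-s) r =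
        b ^ (-(((m : ℝ) + 1) / 2)) / 2 *
          ProbabilityTheory.beta (((m : ℝ) + 1) / 2) (s - ((m : ℝ) + 1) / 2) := by
  set x : ℝ := ((m : ℝ) + 1) / 2 with hx
  have hx0 : 0 < x := by positivity
  obtain ⟨hI, hV⟩ := integrableOn_and_integral_beta hx0 (sub_pos.2 hs)
  set f : ℝ → ℝ := fun r => b * r ^ 2 / (1 + b * r ^ 2) with hf
  have himg : Set.image f (Set.Ioi 0) = Set.Ioo 0 1 := by
    ext t
    constructor
    · rintro ⟨r, hr, rfl⟩
      have hr : 0 < r := hr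
      refine ⟨by positivity, (div_lt_one (by positivity)).2 (by linarith)⟩
    · rintro ⟨h0, h1⟩
      have h1' : 0 < 1 - t := sub_pos.2 h1
      have hsq : √(t / (b * (1 - t))) ^ 2 = t / (b * (1 - t)) := Real.sq_sqrt (by positivity)
      refine ⟨√(t / (b * (1 - t))), Real.sqrt_pos.2 (by positivity), ?_⟩
      simp only [hf, hsq]
      field_simp
      ring
  have hderiv : ∀ r ∈ Set.Ioi (0 : ℝ),
      HasDerivWithinAt f (2 * b * r / (1 + b * r ^ 2) ^ 2) (Set.Ioi 0) r := fun r _ => by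
    have h1 : HasDerivAt (fun r : ℝ => b * r ^ 2) (2 * b * r) r :=
      (hasDerivAt_pow 2 r).const_mul b |>.congr_deriv (by push_cast; ring)
    exact (h1.div (h1.const_add 1) (by positivity) |>.congr_deriv (by ring)).hasDerivWithinAt
  have hinj : Set.InjOn f (Set.Ioi 0) := fun r hr s hs h => by
    have hr' : 0 < 1 + b * r ^ 2 := by positivity
    have hs' : 0 < 1 + b * s ^ 2 := by positivity
    simp only [hf] at h
    rw [div_eq_div_iff hr'.ne' hs'.ne'] at h
    have h2 : r ^ 2 = s ^ 2 := mul_left_cancel₀ hb.ne' (by linarith)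
    exact (pow_left_inj₀ (le_of_lt hr) (le_of_lt hs) two_ne_zero).1 h2
  have hc1 := integrableOn_image_iff_integrableOn_abs_deriv_smul measurableSet_Ioi hderiv hinj
    (fun t : ℝ => t ^ (x - 1) * (1 - t) ^ (s - x - 1))
  have hc2 := integral_image_eq_integral_abs_deriv_smul measurableSet_Ioi hderiv hinj
    (fun t : ℝ => t ^ (x - 1) * (1 - t) ^ (s - x - 1))
  have hEq : Set.EqOn (fun r : ℝ => |2 * b * r / (1 + b * r ^ 2) ^ 2| • ((f r) ^ (x - 1) *
      (1 - f r) ^ (s - x - 1))) (fun r => 2 * b ^ x * (r ^ m * truncPow b (-s) r))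
      (Set.Ioi 0) := by
    intro r hr
    have hr : 0 < r := hr
    have h1 := rpow_radial_exponent hb hr m
    have hpos : 0 < 1 + b * r ^ 2 := by positivity
    have hf1 : 1 - f r = (1 + b * r ^ 2)⁻¹ := by
      simp only [hf]
      field_simp
      ring
    have hW : (1 + b * r ^ 2) ^ (-s) = ((1 + b * r ^ 2) ^ 2)⁻¹ *
        (((1 + b * r ^ 2) ^ (x - 1))⁻¹ * ((1 + b * r ^ 2)⁻¹) ^ (s - x - 1)) := by
      rw [Real.inv_rpow hpos.le, ← Real.rpow_natCast (1 + b * r ^ 2) 2, ← Real.rpow_neg hpos.le,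
        ← Real.rpow_neg hpos.le, ← Real.rpow_neg hpos.le, ← Real.rpow_add hpos,
        ← Real.rpow_add hpos]
      congr 1
      push_cast
      ring
    simp only [smul_eq_mul, truncPow, if_pos hpos, hf1,
      abs_of_pos (by positivity : 0 < 2 * b * r / (1 + b * r ^ 2) ^ 2)]
    rw [hW, ← mul_assoc (2 * b ^ x), hx, ← h1]
    simp only [hf]
    rw [Real.div_rpow (by positivity) hpos.le]
    simp only [div_eq_mul_inv]
    ring
  rw [himg] at hc1 hc2
  rw [integrableOn_congr_fun hEq measurableSet_Ioi] at hc1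
  rw [setIntegral_congr_fun measurableSet_Ioi hEq, hV, integral_const_mul] at hc2
  have hbx : 0 < b ^ x := by positivity
  constructor
  · have := (hc1.1 hI).const_mul (2 * b ^ x)⁻¹
    refine this.congr (Filter.Eventually.of_forall fun r => ?_)
    simp only []
    field_simp
  · rw [hc2, Real.rpow_neg hb.le]
    field_simp

/-- The `n`-dimensional integral of a radial function on Euclidean space. -/
lemma integral_radial {n : ℕ} (hn : 1 ≤ n) (k : ℕ) (g : ℝ → ℝ) :
    ∫ v : EuclideanSpace ℝ (Fin n), ‖v‖ ^ k * g ‖v‖ =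
      2 * Real.pi ^ ((n : ℝ) / 2) / Real.Gamma ((n : ℝ) / 2) *
        ∫ r in Set.Ioi (0 : ℝ), r ^ (n - 1 + k) * g r := by
  have : Nonempty (Fin n) := ⟨⟨0, hn⟩⟩
  have hn0 : (0 : ℝ) < n := by exact_mod_cast hn
  have hG := Real.Gamma_pos_of_pos (half_pos hn0)
  have h := integral_fun_norm_addHaar (volume : Measure (EuclideanSpace ℝ (Fin n)))
    (fun r => r ^ k * g r)
  simp only [finrank_euclideanSpace, Fintype.card_fin, smul_eq_mul, nsmul_eq_mul,
    Measure.real, EuclideanSpace.volume_ball] at h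
  rw [h, ← mul_assoc]
  congr 1
  · rw [ENNReal.ofReal_one, one_pow, one_mul, ENNReal.toReal_ofReal (by positivity),
      Real.Gamma_add_one (by positivity), Real.sqrt_eq_rpow, ← Real.rpow_natCast,
      ← Real.rpow_mul Real.pi_pos.le, one_div_mul_eq_div]
    field_simp
  · simp only [pow_add, mul_assoc]

lemma integrable_radial_iff {n : ℕ} (hn : 1 ≤ n) (k : ℕ) (g : ℝ → ℝ) :
    Integrable (fun v : EuclideanSpace ℝ (Fin n) => ‖v‖ ^ k * g ‖v‖) ↔
      IntegrableOn (fun r : ℝ => r ^ (n - 1 + k) * g r) (Set.Ioi 0) := by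
  have : Nonempty (Fin n) := ⟨⟨0, hn⟩⟩
  have h := integrable_fun_norm_addHaar (volume : Measure (EuclideanSpace ℝ (Fin n)))
    (f := fun r => r ^ k * g r)
  simp only [finrank_euclideanSpace, Fintype.card_fin, smul_eq_mul] at h
  simpa only [pow_add, mul_assoc] using h

lemma gaussA_denominator_pos {n : ℕ} {p : ℝ} (hp₁ : (n : ℝ) / (n + 2) < p) :
    0 < 2 * p - n * (1 - p) := by
  rw [div_lt_iff₀ (by positivity)] at hp₁
  linarith

lemma natCast_sub_one_add_add_one {n : ℕ} (hn : 1 ≤ n) (k : ℕ) :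
    ((n - 1 + k : ℕ) : ℝ) + 1 = n + k := by
  have : n - 1 + k + 1 = n + k := by omega
  exact_mod_cast this

/-- Integrability of the radial weights appearing in the Fisher information. -/
lemma integrable_norm_pow_mul_truncPow {n : ℕ} (hn : 1 ≤ n) {p : ℝ}
    (hp₁ : (n : ℝ) / (n + 2) < p) (hp₂ : p < 2) (hp₃ : p ≠ 1) {j k : ℕ} (hj : j ≤ 2)
    (hk : k ≤ 2 * j) :
    Integrable (fun v : EuclideanSpace ℝ (Fin n) =>
      ‖v‖ ^ k * truncPow ((1 - p) / (2 * p - n * (1 - p))) (1 / (p - 1) - j) ‖v‖) := by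
  have hc := gaussA_denominator_pos hp₁
  rw [integrable_radial_iff hn]
  have hj' : (j : ℝ) ≤ 2 := by exact_mod_cast hj
  rcases lt_or_gt_of_ne hp₃ with hp | hp
  · have hq : 0 < 1 - p := sub_pos.2 hp
    have hs : ((n - 1 + k : ℕ) + 1 : ℝ) / 2 < 1 / (1 - p) + j := by
      rw [natCast_sub_one_add_add_one hn]
      have hk' : (k : ℝ) ≤ 2 * j := by exact_mod_cast hk
      have : (n : ℝ) / 2 < 1 / (1 - p) := by
        rw [div_lt_div_iff₀ two_pos hq]
        nlinarith
      linarith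
    have := (integrableOn_and_integral_truncPow_pos (div_pos hq hc) _ hs).1
    convert this using 5
    rw [← neg_sub 1 p, div_neg]
    ring
  · have hq : 0 < p - 1 := sub_pos.2 hp
    have he : 0 < 1 / (p - 1) - j + 1 := by
      have : 1 < 1 / (p - 1) := by
        rw [lt_div_iff₀ hq]
        linarith
      linarith
    have := (integrableOn_and_integral_truncPow_neg (div_pos hq hc) he (n - 1 + k)).1
    convert this using 5
    rw [← neg_div, neg_sub]

/-- The even radial moments of the weights, in terms of the normalization constant. -/
lemma gaussA_mul_integral_truncPow {n : ℕ} (hn : 1 ≤ n) {p : ℝ}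
    (hp₁ : (n : ℝ) / (n + 2) < p) (hp₂ : p < 2) (hp₃ : p ≠ 1) {j : ℕ} (hj : j ≤ 2) :
    gaussA n p * ∫ v : EuclideanSpace ℝ (Fin n),
      ‖v‖ ^ (2 * j) * truncPow ((1 - p) / (2 * p - n * (1 - p))) (1 / (p - 1) - j) ‖v‖ =
    if 1 < p then
      ((p - 1) / (2 * p - n * (1 - p)))⁻¹ ^ j * (Real.Gamma (n / 2 + j) / Real.Gamma (n / 2)) *
        (Real.Gamma (1 / (p - 1) + 1 - j) / Real.Gamma (1 / (p - 1) + 1))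
    else ((1 - p) / (2 * p - n * (1 - p)))⁻¹ ^ j *
        (Real.Gamma (n / 2 + j) / Real.Gamma (n / 2)) *
        (Real.Gamma (1 / (1 - p)) / Real.Gamma (1 / (1 - p) + j)) := by
  have hc := gaussA_denominator_pos hp₁
  have hn0 : (0 : ℝ) < n := by exact_mod_cast hn
  have hj' : (j : ℝ) ≤ 2 := by exact_mod_cast hj
  have hG := Real.Gamma_pos_of_pos (half_pos hn0)
  have hπ : 0 < Real.pi ^ ((n : ℝ) / 2) := by positivity
  rw [integral_radial hn]
  rcases lt_or_gt_of_ne hp₃ with hp | hp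
  · have hq : 0 < 1 - p := sub_pos.2 hp
    have hlt : (n : ℝ) / 2 < 1 / (1 - p) := by
      rw [div_lt_div_iff₀ two_pos hq]
      nlinarith
    have hs : ((n - 1 + 2 * j : ℕ) + 1 : ℝ) / 2 < 1 / (1 - p) + j := by
      rw [natCast_sub_one_add_add_one hn]
      push_cast
      linarith
    have he : 1 / (p - 1) - j = -(1 / (1 - p) + j) := by
      rw [← neg_sub 1 p, div_neg]
      ring
    have hb := div_pos hq hc
    rw [he, (integrableOn_and_integral_truncPow_pos hb _ hs).2, if_neg hp.not_gt, gaussA,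
      if_neg hp.not_gt, natCast_sub_one_add_add_one hn]
    set b := (1 - p) / (2 * p - n * (1 - p)) with hbdef
    set s := 1 / (1 - p) with hsdef
    have h1 : ((n : ℝ) + (2 * j : ℕ)) / 2 = n / 2 + j := by
      push_cast
      ring
    have h2 : s + j - ((n : ℝ) / 2 + j) = s - n / 2 := by ring
    have h3 : (n : ℝ) / 2 + j + (s - n / 2) = s + j := by ring
    have hG1 := Real.Gamma_pos_of_pos (sub_pos.2 hlt)
    have hG2 : 0 < Real.Gamma (s + j) := Real.Gamma_pos_of_pos (by positivity)
    rw [h1, h2, ProbabilityTheory.beta, h3, Real.rpow_neg hb.le, Real.rpow_add hb,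
      Real.rpow_natCast, inv_pow]
    have hbn : 0 < b ^ ((n : ℝ) / 2) := by positivity
    generalize Real.Gamma (s - n / 2) = G at hG1 ⊢
    field_simp
  · have hq : 0 < p - 1 := sub_pos.2 hp
    have ha : 1 < 1 / (p - 1) := by
      rw [lt_div_iff₀ hq]
      linarith
    have he : 0 < 1 / (p - 1) - j + 1 := by linarith
    have hb := div_pos hq hc
    have hneg : (1 - p) / (2 * p - n * (1 - p)) = -((p - 1) / (2 * p - n * (1 - p))) := by
      rw [← neg_div, neg_sub]
    have hpa : p / (p - 1) = 1 / (p - 1) + 1 := by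
      field_simp
      ring
    rw [hneg, (integrableOn_and_integral_truncPow_neg hb he _).2, if_pos hp, gaussA,
      if_pos hp, natCast_sub_one_add_add_one hn, hpa]
    set b := (p - 1) / (2 * p - n * (1 - p)) with hbdef
    set a := 1 / (p - 1) with hadef
    have h1 : ((n : ℝ) + (2 * j : ℕ)) / 2 = n / 2 + j := by
      push_cast
      ring
    have h3 : (n : ℝ) / 2 + j + (a - j + 1) = a + 1 + n / 2 := by ring
    have h4 : a - j + 1 = a + 1 - j := by ring
    have hG1 : 0 < Real.Gamma (a + 1) := Real.Gamma_pos_of_pos (by linarith)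
    have hG2 : 0 < Real.Gamma (a + 1 + n / 2) := Real.Gamma_pos_of_pos (by positivity)
    rw [h1, ProbabilityTheory.beta, h3, h4, Real.rpow_neg hb.le, Real.rpow_add hb,
      Real.rpow_natCast, inv_pow]
    have hbn : 0 < b ^ ((n : ℝ) / 2) := by positivity
    field_simp

lemma gaussA_pos_s10 {n : ℕ} {p : ℝ} (hp₁ : (n : ℝ) / (n + 2) < p) (hp₃ : p ≠ 1) :
    0 < gaussA n p := by
  have hc := gaussA_denominator_pos hp₁
  unfold gaussA
  rcases lt_or_gt_of_ne hp₃ with hp | hp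
  · have hq : 0 < 1 - p := sub_pos.2 hp
    have hlt : (n : ℝ) / 2 < 1 / (1 - p) := by
      rw [div_lt_div_iff₀ two_pos hq]
      nlinarith
    rw [if_neg hp.not_gt]
    have hG1 := Real.Gamma_pos_of_pos (sub_pos.2 hlt)
    have hG2 : 0 < Real.Gamma (1 / (1 - p)) := Real.Gamma_pos_of_pos (by positivity)
    positivity
  · have hq : 0 < p - 1 := sub_pos.2 hp
    have hp0 : 0 < p := by linarith
    rw [if_pos hp]
    have hG1 : 0 < Real.Gamma (p / (p - 1)) := Real.Gamma_pos_of_pos (by positivity)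
    have hG2 : 0 < Real.Gamma (p / (p - 1) + n / 2) := Real.Gamma_pos_of_pos (by positivity)
    positivity

lemma gaussA_mul_integral_truncPow_zero {n : ℕ} (hn : 1 ≤ n) {p : ℝ}
    (hp₁ : (n : ℝ) / (n + 2) < p) (hp₂ : p < 2) (hp₃ : p ≠ 1) :
    gaussA n p * ∫ v : EuclideanSpace ℝ (Fin n),
      truncPow ((1 - p) / (2 * p - n * (1 - p))) (1 / (p - 1)) ‖v‖ = 1 := by
  have h := gaussA_mul_integral_truncPow hn hp₁ hp₂ hp₃ (j := 0) (by norm_num)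
  have hn0 : (0 : ℝ) < n := by exact_mod_cast hn
  have hG := Real.Gamma_pos_of_pos (half_pos hn0)
  simp only [mul_zero, pow_zero, one_mul, Nat.cast_zero, sub_zero, add_zero] at h
  rw [h, div_self hG.ne']
  split_ifs with hp
  · have hq : 0 < p - 1 := sub_pos.2 hp
    rw [one_mul, div_self (Real.Gamma_pos_of_pos (by positivity)).ne']
  · have hq : 0 < 1 - p := sub_pos.2 (lt_of_le_of_ne (not_lt.1 hp) hp₃)
    rw [one_mul, div_self (Real.Gamma_pos_of_pos (by positivity)).ne']

lemma gaussA_mul_integral_truncPow_one {n : ℕ} (hn : 1 ≤ n) {p : ℝ}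
    (hp₁ : (n : ℝ) / (n + 2) < p) (hp₂ : p < 2) (hp₃ : p ≠ 1) :
    gaussA n p * ∫ v : EuclideanSpace ℝ (Fin n),
      ‖v‖ ^ 2 * truncPow ((1 - p) / (2 * p - n * (1 - p))) (1 / (p - 1) - 1) ‖v‖ =
    n * (2 * p - n * (1 - p)) / 2 := by
  have h := gaussA_mul_integral_truncPow hn hp₁ hp₂ hp₃ (j := 1) (by norm_num)
  have hn0 : (0 : ℝ) < n := by exact_mod_cast hn
  have hG := Real.Gamma_pos_of_pos (half_pos hn0)
  have hc := gaussA_denominator_pos hp₁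
  simp only [mul_one, pow_one, Nat.cast_one] at h
  rw [h, Real.Gamma_add_one (half_pos hn0).ne']
  split_ifs with hp
  · have hq : 0 < p - 1 := sub_pos.2 hp
    have hG1 : 0 < Real.Gamma (1 / (p - 1)) := Real.Gamma_pos_of_pos (by positivity)
    rw [add_sub_cancel_right, Real.Gamma_add_one (by positivity)]
    field_simp
  · have hq : 0 < 1 - p := sub_pos.2 (lt_of_le_of_ne (not_lt.1 hp) hp₃)
    have hG1 : 0 < Real.Gamma (1 / (1 - p)) := Real.Gamma_pos_of_pos (by positivity)
    rw [Real.Gamma_add_one (by positivity)]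
    field_simp

lemma gaussA_mul_integral_truncPow_two {n : ℕ} (hn : 1 ≤ n) {p : ℝ}
    (hp₁ : (n : ℝ) / (n + 2) < p) (hp₂ : p < 2) (hp₃ : p ≠ 1) :
    gaussA n p * ∫ v : EuclideanSpace ℝ (Fin n),
      ‖v‖ ^ 4 * truncPow ((1 - p) / (2 * p - n * (1 - p))) (1 / (p - 1) - 2) ‖v‖ =
    n * (n + 2) * (2 * p - n * (1 - p)) ^ 2 / (4 * (2 - p)) := by
  have h := gaussA_mul_integral_truncPow hn hp₁ hp₂ hp₃ (j := 2) le_rfl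
  have hn0 : (0 : ℝ) < n := by exact_mod_cast hn
  have hG := Real.Gamma_pos_of_pos (half_pos hn0)
  have hc := gaussA_denominator_pos hp₁
  have h2p : 0 < 2 - p := sub_pos.2 hp₂
  simp only [Nat.cast_ofNat, show 2 * 2 = 4 from rfl] at h
  have hadd : ∀ z : ℝ, 0 < z → Real.Gamma (z + 2) = (z + 1) * (z * Real.Gamma z) := fun z hz => by
    rw [show z + 2 = z + 1 + 1 by ring, Real.Gamma_add_one (by positivity),
      Real.Gamma_add_one hz.ne']
  rw [h, hadd _ (half_pos hn0)]
  split_ifs with hp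
  · have hq : 0 < p - 1 := sub_pos.2 hp
    have ha : 0 < 1 / (p - 1) - 1 := by
      rw [sub_pos, lt_div_iff₀ hq]
      linarith
    have hG1 := Real.Gamma_pos_of_pos ha
    have ha' : 1 / (p - 1) - 1 = (2 - p) / (p - 1) := by
      field_simp
      ring
    rw [show 1 / (p - 1) + 1 - 2 = 1 / (p - 1) - 1 by ring,
      show 1 / (p - 1) + 1 = (1 / (p - 1) - 1) + 2 by ring, hadd _ ha]
    rw [ha'] at hG1 ⊢
    field_simp
    ring
  · have hq : 0 < 1 - p := sub_pos.2 (lt_of_le_of_ne (not_lt.1 hp) hp₃)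
    have hG1 : 0 < Real.Gamma (1 / (1 - p)) := Real.Gamma_pos_of_pos (by positivity)
    have ha' : 1 / (1 - p) + 1 = (2 - p) / (1 - p) := by
      field_simp
      ring
    rw [hadd _ (by positivity), ha']
    field_simp
    ring

lemma integrable_mul_radial {n k : ℕ} {g : ℝ → ℝ} (hg : Measurable g)
    (hi : Integrable (fun v : EuclideanSpace ℝ (Fin n) => ‖v‖ ^ k * g ‖v‖))
    {h : EuclideanSpace ℝ (Fin n) → ℝ} (hh : Continuous h) {C : ℝ}
    (hC : ∀ v, |h v| ≤ C * ‖v‖ ^ k) :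
    Integrable (fun v => h v * g ‖v‖) := by
  refine (hi.const_mul C).mono ?_ (Filter.Eventually.of_forall fun v => ?_)
  · exact (hh.measurable.mul (hg.comp measurable_norm)).aestronglyMeasurable
  · have := (hC v).trans (le_abs_self _)
    rw [abs_mul, abs_of_nonneg (by positivity : 0 ≤ ‖v‖ ^ k)] at this
    simp only [norm_mul, Real.norm_eq_abs, abs_pow, abs_norm, ← mul_assoc]
    gcongr

/-- A directional moment of a radial weight depends only on the length of the direction. -/
lemma integral_inner_pow_eq_of_norm_eq {n : ℕ} (k : ℕ) (g : ℝ → ℝ)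
    {a b : EuclideanSpace ℝ (Fin n)} (hab : ‖a‖ = ‖b‖) :
    ∫ v, inner ℝ a v ^ k * g ‖v‖ = ∫ v, inner ℝ b v ^ k * g ‖v‖ := by
  set R := (Submodule.span ℝ {a - b})ᗮ.reflection with hR
  have hRa : R a = b := Submodule.reflection_sub hab
  rw [← R.measurePreserving.integral_comp R.toHomeomorph.measurableEmbedding
    (fun v => inner ℝ b v ^ k * g ‖v‖)]
  simp only [← hRa, LinearIsometryEquiv.inner_map_map, LinearIsometryEquiv.norm_map]

lemma integral_inner_pow {n : ℕ} (k : ℕ) (g : ℝ → ℝ)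
    {e : EuclideanSpace ℝ (Fin n)} (he : ‖e‖ = 1) (a : EuclideanSpace ℝ (Fin n)) :
    ∫ v, inner ℝ a v ^ k * g ‖v‖ = ‖a‖ ^ k * ∫ v, inner ℝ e v ^ k * g ‖v‖ := by
  rw [integral_inner_pow_eq_of_norm_eq k g (b := ‖a‖ • e) (by simp [norm_smul, he]),
    ← integral_const_mul]
  simp only [real_inner_smul_left, mul_pow, mul_assoc]

lemma integrable_inner_pow {n k : ℕ} {g : ℝ → ℝ} (hg : Measurable g)
    (hi : Integrable (fun v : EuclideanSpace ℝ (Fin n) => ‖v‖ ^ k * g ‖v‖))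
    (a : EuclideanSpace ℝ (Fin n)) :
    Integrable (fun v => inner ℝ a v ^ k * g ‖v‖) := by
  refine integrable_mul_radial hg hi (by fun_prop) (C := ‖a‖ ^ k) fun v => ?_
  rw [abs_pow, ← mul_pow]
  exact pow_le_pow_left₀ (abs_nonneg _) (abs_real_inner_le_norm a v) k

/-- Second moments of a radial weight along two directions, by polarization. -/
lemma integral_inner_mul_inner_aux {n : ℕ} {g : ℝ → ℝ} (hg : Measurable g)
    (hi : Integrable (fun v : EuclideanSpace ℝ (Fin n) => ‖v‖ ^ 2 * g ‖v‖))
    {e : EuclideanSpace ℝ (Fin n)} (he : ‖e‖ = 1) (a b : EuclideanSpace ℝ (Fin n)) :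
    ∫ v, inner ℝ a v * inner ℝ b v * g ‖v‖ =
      inner ℝ a b * ∫ v, inner ℝ e v ^ 2 * g ‖v‖ := by
  set s : Bool → ℝ := fun q => cond q 1 (-1) with hs
  have hpol : ∀ v, inner ℝ a v * inner ℝ b v * g ‖v‖ =
      ∑ q : Bool, s q / 4 * (inner ℝ (a + s q • b) v ^ 2 * g ‖v‖) := fun v => by
    simp [hs, inner_add_left]
    ring
  simp_rw [hpol]
  rw [integral_finsetSum _ fun q _ => (integrable_inner_pow hg hi _).const_mul _]
  have hint := integral_inner_pow 2 g he
  generalize ∫ v, inner ℝ e v ^ 2 * g ‖v‖ = C at hint ⊢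
  have h2 : ∀ w : EuclideanSpace ℝ (Fin n), ‖w‖ ^ 2 = inner ℝ w w := fun w =>
    (real_inner_self_eq_norm_sq w).symm
  simp_rw [integral_const_mul, hint, h2]
  simp only [inner_add_left, inner_add_right, real_inner_smul_left, real_inner_smul_right,
    real_inner_comm a b, Fintype.sum_bool, hs, cond_true, cond_false]
  ring

/-- Fourth moments of a radial weight along four directions, by polarization. -/
lemma integral_inner_mul_inner_mul_inner_mul_inner_aux {n : ℕ} {g : ℝ → ℝ} (hg : Measurable g)
    (hi : Integrable (fun v : EuclideanSpace ℝ (Fin n) => ‖v‖ ^ 4 * g ‖v‖))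
    {e : EuclideanSpace ℝ (Fin n)} (he : ‖e‖ = 1) (a b c d : EuclideanSpace ℝ (Fin n)) :
    ∫ v, inner ℝ a v * inner ℝ b v * (inner ℝ c v * inner ℝ d v) * g ‖v‖ =
      (inner ℝ a b * inner ℝ c d + inner ℝ a c * inner ℝ b d + inner ℝ a d * inner ℝ b c) *
        ((∫ v, inner ℝ e v ^ 4 * g ‖v‖) / 3) := by
  set s : Bool → ℝ := fun q => cond q 1 (-1) with hs
  have hpol : ∀ v, inner ℝ a v * inner ℝ b v * (inner ℝ c v * inner ℝ d v) * g ‖v‖ =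
      ∑ q : Bool × Bool × Bool, s q.1 * s q.2.1 * s q.2.2 / 192 *
        (inner ℝ (a + s q.1 • b + s q.2.1 • c + s q.2.2 • d) v ^ 4 * g ‖v‖) := fun v => by
    simp [hs, inner_add_left, Fintype.sum_prod_type]
    ring
  simp_rw [hpol]
  rw [integral_finsetSum _ fun q _ => (integrable_inner_pow hg hi _).const_mul _]
  have h4 : ∀ w : EuclideanSpace ℝ (Fin n), ‖w‖ ^ 4 = inner ℝ w w ^ 2 := fun w => by
    rw [real_inner_self_eq_norm_sq]
    ring
  have hint := integral_inner_pow 4 g he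
  generalize ∫ v, inner ℝ e v ^ 4 * g ‖v‖ = C at hint ⊢
  simp_rw [integral_const_mul, hint, h4]
  simp only [inner_add_left, inner_add_right, real_inner_smul_left, real_inner_smul_right,
    real_inner_comm a b, real_inner_comm a c, real_inner_comm a d, real_inner_comm b c,
    real_inner_comm b d, real_inner_comm c d, Fintype.sum_prod_type, Fintype.sum_bool, hs,
    cond_true, cond_false]
  ring

lemma norm_sq_eq_sum_inner_single {n : ℕ} (v : EuclideanSpace ℝ (Fin n)) :
    ‖v‖ ^ 2 = ∑ i, inner ℝ (EuclideanSpace.single i (1 : ℝ)) v *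
      inner ℝ (EuclideanSpace.single i (1 : ℝ)) v := by
  rw [EuclideanSpace.real_norm_sq_eq]
  simp [EuclideanSpace.inner_single_left, sq]

lemma abs_inner_mul_inner_le {n : ℕ} (a b v : EuclideanSpace ℝ (Fin n)) :
    |inner ℝ a v * inner ℝ b v| ≤ ‖a‖ * ‖b‖ * ‖v‖ ^ 2 := by
  rw [abs_mul]
  calc _ ≤ (‖a‖ * ‖v‖) * (‖b‖ * ‖v‖) :=
        mul_le_mul (abs_real_inner_le_norm a v) (abs_real_inner_le_norm b v) (abs_nonneg _)
          (by positivity)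
    _ = _ := by ring

lemma integrable_inner_mul_inner {n : ℕ} {g : ℝ → ℝ} (hg : Measurable g)
    (hi : Integrable (fun v : EuclideanSpace ℝ (Fin n) => ‖v‖ ^ 2 * g ‖v‖))
    (a b : EuclideanSpace ℝ (Fin n)) :
    Integrable (fun v => inner ℝ a v * inner ℝ b v * g ‖v‖) :=
  integrable_mul_radial hg hi (by fun_prop) (abs_inner_mul_inner_le a b)

lemma integrable_inner_mul_inner_mul_inner_mul_inner {n : ℕ} {g : ℝ → ℝ} (hg : Measurable g)
    (hi : Integrable (fun v : EuclideanSpace ℝ (Fin n) => ‖v‖ ^ 4 * g ‖v‖))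
    (a b c d : EuclideanSpace ℝ (Fin n)) :
    Integrable (fun v => inner ℝ a v * inner ℝ b v * (inner ℝ c v * inner ℝ d v) * g ‖v‖) := by
  refine integrable_mul_radial hg hi (by fun_prop) (C := ‖a‖ * ‖b‖ * (‖c‖ * ‖d‖)) fun v => ?_
  rw [abs_mul]
  calc _ ≤ (‖a‖ * ‖b‖ * ‖v‖ ^ 2) * (‖c‖ * ‖d‖ * ‖v‖ ^ 2) :=
        mul_le_mul (abs_inner_mul_inner_le a b v) (abs_inner_mul_inner_le c d v) (abs_nonneg _)
          (by positivity)
    _ = _ := by ring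

/-- Second moments of a radial weight. -/
lemma integral_inner_mul_inner {n : ℕ} (hn : 1 ≤ n) {g : ℝ → ℝ} (hg : Measurable g)
    (hi : Integrable (fun v : EuclideanSpace ℝ (Fin n) => ‖v‖ ^ 2 * g ‖v‖))
    (a b : EuclideanSpace ℝ (Fin n)) :
    ∫ v, inner ℝ a v * inner ℝ b v * g ‖v‖ =
      inner ℝ a b * ((∫ v : EuclideanSpace ℝ (Fin n), ‖v‖ ^ 2 * g ‖v‖) / n) := by
  have hn0 : (0 : ℝ) < n := by exact_mod_cast hn
  have he : ‖EuclideanSpace.single (⟨0, hn⟩ : Fin n) (1 : ℝ)‖ = 1 := by simp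
  rw [integral_inner_mul_inner_aux hg hi he]
  simp_rw [norm_sq_eq_sum_inner_single, Finset.sum_mul]
  rw [integral_finsetSum _ fun i _ => integrable_inner_mul_inner hg hi _ _]
  simp_rw [integral_inner_mul_inner_aux hg hi he]
  congr 1
  simp
  field_simp

/-- Fourth moments of a radial weight. -/
lemma integral_inner_mul_inner_mul_inner_mul_inner {n : ℕ} (hn : 1 ≤ n) {g : ℝ → ℝ}
    (hg : Measurable g)
    (hi : Integrable (fun v : EuclideanSpace ℝ (Fin n) => ‖v‖ ^ 4 * g ‖v‖))
    (a b c d : EuclideanSpace ℝ (Fin n)) :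
    ∫ v, inner ℝ a v * inner ℝ b v * (inner ℝ c v * inner ℝ d v) * g ‖v‖ =
      (inner ℝ a b * inner ℝ c d + inner ℝ a c * inner ℝ b d + inner ℝ a d * inner ℝ b c) *
        ((∫ v : EuclideanSpace ℝ (Fin n), ‖v‖ ^ 4 * g ‖v‖) / (n * (n + 2))) := by
  have hn0 : (0 : ℝ) < n := by exact_mod_cast hn
  have he : ‖EuclideanSpace.single (⟨0, hn⟩ : Fin n) (1 : ℝ)‖ = 1 := by simp
  rw [integral_inner_mul_inner_mul_inner_mul_inner_aux hg hi he]
  have h4 : ∀ v : EuclideanSpace ℝ (Fin n), ‖v‖ ^ 4 = ‖v‖ ^ 2 * ‖v‖ ^ 2 := fun v => by ring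
  simp_rw [h4, norm_sq_eq_sum_inner_single, Finset.sum_mul_sum, Finset.sum_mul]
  rw [integral_finsetSum _ fun i _ => integrable_finsetSum _ fun j _ =>
    integrable_inner_mul_inner_mul_inner_mul_inner hg hi _ _ _ _]
  simp_rw [integral_finsetSum _ fun j _ =>
    integrable_inner_mul_inner_mul_inner_mul_inner hg hi _ _ _ _,
    integral_inner_mul_inner_mul_inner_mul_inner_aux hg hi he]
  congr 1
  simp [EuclideanSpace.inner_single_left, ← Finset.sum_mul, Finset.sum_add_distrib]
  field_simp
  ring

lemma dotProduct_mulVec_eq_sum_inner {n : ℕ} (X : Matrix (Fin n) (Fin n) ℝ)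
    (v : EuclideanSpace ℝ (Fin n)) :
    v.ofLp ⬝ᵥ X *ᵥ v.ofLp = ∑ i, ∑ j, X i j * (inner ℝ (EuclideanSpace.single i (1 : ℝ)) v *
      inner ℝ (EuclideanSpace.single j (1 : ℝ)) v) := by
  simp only [dotProduct, mulVec, Finset.mul_sum]
  refine Finset.sum_congr rfl fun i _ => Finset.sum_congr rfl fun j _ => ?_
  simp [EuclideanSpace.inner_single_left]
  ring

lemma exists_abs_dotProduct_mulVec_le {n : ℕ} (X : Matrix (Fin n) (Fin n) ℝ) :
    ∃ C, 0 ≤ C ∧ ∀ v : EuclideanSpace ℝ (Fin n), |v.ofLp ⬝ᵥ X *ᵥ v.ofLp| ≤ C * ‖v‖ ^ 2 := by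
  refine ⟨∑ i, ∑ j, |X i j|, by positivity, fun v => ?_⟩
  rw [dotProduct_mulVec_eq_sum_inner, Finset.sum_mul]
  refine (Finset.abs_sum_le_sum_abs _ _).trans (Finset.sum_le_sum fun i _ => ?_)
  rw [Finset.sum_mul]
  refine (Finset.abs_sum_le_sum_abs _ _).trans (Finset.sum_le_sum fun j _ => ?_)
  rw [abs_mul]
  gcongr
  simpa using abs_inner_mul_inner_le (EuclideanSpace.single i (1 : ℝ))
    (EuclideanSpace.single j (1 : ℝ)) v

lemma continuous_dotProduct_mulVec {n : ℕ} (X : Matrix (Fin n) (Fin n) ℝ) :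
    Continuous fun v : EuclideanSpace ℝ (Fin n) => v.ofLp ⬝ᵥ X *ᵥ v.ofLp := by
  simp_rw [dotProduct_mulVec_eq_sum_inner]
  fun_prop

lemma integral_dotProduct_mulVec {n : ℕ} (hn : 1 ≤ n) {g : ℝ → ℝ} (hg : Measurable g)
    (hi : Integrable (fun v : EuclideanSpace ℝ (Fin n) => ‖v‖ ^ 2 * g ‖v‖))
    (X : Matrix (Fin n) (Fin n) ℝ) :
    ∫ v : EuclideanSpace ℝ (Fin n), v.ofLp ⬝ᵥ X *ᵥ v.ofLp * g ‖v‖ =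
      X.trace * ((∫ v : EuclideanSpace ℝ (Fin n), ‖v‖ ^ 2 * g ‖v‖) / n) := by
  set e : Fin n → EuclideanSpace ℝ (Fin n) := fun i => EuclideanSpace.single i 1 with he
  have hpt : ∀ v : EuclideanSpace ℝ (Fin n), v.ofLp ⬝ᵥ X *ᵥ v.ofLp * g ‖v‖ =
      ∑ q : Fin n × Fin n, X q.1 q.2 * (inner ℝ (e q.1) v * inner ℝ (e q.2) v * g ‖v‖) :=
      fun v => by
    rw [dotProduct_mulVec_eq_sum_inner, ← Fintype.sum_prod_type', Finset.sum_mul]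
    exact Finset.sum_congr rfl fun q _ => by ring
  simp_rw [hpt]
  rw [integral_finsetSum _ fun q _ => (integrable_inner_mul_inner hg hi _ _).const_mul _]
  simp_rw [integral_const_mul, integral_inner_mul_inner hn hg hi, ← mul_assoc, ← Finset.sum_mul]
  congr 1
  simp [Fintype.sum_prod_type, he, EuclideanSpace.inner_single_left, trace]

lemma integral_dotProduct_mulVec_mul {n : ℕ} (hn : 1 ≤ n) {g : ℝ → ℝ} (hg : Measurable g)
    (hi : Integrable (fun v : EuclideanSpace ℝ (Fin n) => ‖v‖ ^ 4 * g ‖v‖))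
    (X Y : Matrix (Fin n) (Fin n) ℝ) (hY : Y.IsSymm) :
    ∫ v : EuclideanSpace ℝ (Fin n), v.ofLp ⬝ᵥ X *ᵥ v.ofLp * (v.ofLp ⬝ᵥ Y *ᵥ v.ofLp) * g ‖v‖ =
      (X.trace * Y.trace + 2 * (X * Y).trace) *
        ((∫ v : EuclideanSpace ℝ (Fin n), ‖v‖ ^ 4 * g ‖v‖) / (n * (n + 2))) := by
  set M := (∫ v : EuclideanSpace ℝ (Fin n), ‖v‖ ^ 4 * g ‖v‖) / (n * (n + 2)) with hM
  set e : Fin n → EuclideanSpace ℝ (Fin n) := fun i => EuclideanSpace.single i 1 with he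
  have hpt : ∀ v : EuclideanSpace ℝ (Fin n),
      v.ofLp ⬝ᵥ X *ᵥ v.ofLp * (v.ofLp ⬝ᵥ Y *ᵥ v.ofLp) * g ‖v‖ =
      ∑ q : (Fin n × Fin n) × (Fin n × Fin n), X q.1.1 q.1.2 * Y q.2.1 q.2.2 *
        (inner ℝ (e q.1.1) v * inner ℝ (e q.1.2) v *
          (inner ℝ (e q.2.1) v * inner ℝ (e q.2.2) v) * g ‖v‖) := fun v => by
    rw [dotProduct_mulVec_eq_sum_inner, dotProduct_mulVec_eq_sum_inner,
      ← Fintype.sum_prod_type', ← Fintype.sum_prod_type', Finset.sum_mul_sum,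
      ← Fintype.sum_prod_type', Finset.sum_mul]
    exact Finset.sum_congr rfl fun q _ => by ring
  simp_rw [hpt]
  rw [integral_finsetSum _ fun q _ =>
    (integrable_inner_mul_inner_mul_inner_mul_inner hg hi _ _ _ _).const_mul _]
  simp_rw [integral_const_mul, integral_inner_mul_inner_mul_inner_mul_inner hn hg hi, ← hM,
    ← mul_assoc, ← Finset.sum_mul]
  congr 1
  simp only [Fintype.sum_prod_type, he, EuclideanSpace.inner_single_left, map_one, one_mul,
    PiLp.single_apply, mul_add, Finset.sum_add_distrib]
  have h1 : X.trace * Y.trace = ∑ i, ∑ j, X i i * Y j j := Finset.sum_mul_sum _ _ _ _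
  have h2 : (X * Y).trace = ∑ i, ∑ j, X i j * Y j i := rfl
  have hY' : ∀ i j, Y j i = Y i j := fun i j => hY.apply i j
  rw [h1, h2]
  simp [hY']
  ring

lemma truncPow_div (β e r : ℝ) :
    truncPow β e r / (1 + β * r ^ 2) = truncPow β (e - 1) r := by
  unfold truncPow
  split_ifs with h
  · rw [Real.rpow_sub_one h.ne']
  · simp

lemma integral_odd_mul_radial {n : ℕ} (g : ℝ → ℝ) {h : EuclideanSpace ℝ (Fin n) → ℝ}
    (hodd : ∀ v, h (-v) = -h v) : ∫ v, h v * g ‖v‖ = 0 := by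
  have h1 := integral_neg_eq_self (fun v => h v * g ‖v‖)
    (volume : Measure (EuclideanSpace ℝ (Fin n)))
  simp only [hodd, norm_neg, neg_mul, integral_neg] at h1
  linarith

/-- The Fisher information at the standard `p`-Gaussian, in Euclidean coordinates. -/
lemma fisher_standard {n : ℕ} (hn : 1 ≤ n) {p : ℝ}
    (hp₁ : (n : ℝ) / (n + 2) < p) (hp₂ : p < 2) (hp₃ : p ≠ 1)
    (X Y : Matrix (Fin n) (Fin n) ℝ) (hY : Y.IsSymm) (x y : EuclideanSpace ℝ (Fin n))
    {c β a : ℝ} (hc : c = 2 * p - n * (1 - p)) (hβ : β = (1 - p) / c) (ha : a = 1 / (p - 1)) :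
    gaussA n p * ∫ v : EuclideanSpace ℝ (Fin n), truncPow β a ‖v‖ *
      (X.trace / 2 - (v.ofLp ⬝ᵥ X *ᵥ v.ofLp - 2 * inner ℝ x v) / (1 + β * ‖v‖ ^ 2) / c) *
      (Y.trace / 2 - (v.ofLp ⬝ᵥ Y *ᵥ v.ofLp - 2 * inner ℝ y v) / (1 + β * ‖v‖ ^ 2) / c) =
    1 / (2 * (2 - p)) * (X * Y).trace + (p - 1) / (4 * (2 - p)) * X.trace * Y.trace +
      (2 + n * (p - 1)) / (c * (2 - p)) * inner ℝ x y := by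
  have hc0 : 0 < c := hc ▸ gaussA_denominator_pos hp₁
  have hn0 : (0 : ℝ) < n := by exact_mod_cast hn
  have h2p : 0 < 2 - p := sub_pos.2 hp₂
  have hA := (gaussA_pos_s10 hp₁ hp₃).ne'
  have hint : ∀ j k : ℕ, j ≤ 2 → k ≤ 2 * j → Integrable (fun v : EuclideanSpace ℝ (Fin n) =>
      ‖v‖ ^ k * truncPow β (a - j) ‖v‖) := fun j k hj hk => by
    rw [hβ, ha, hc]
    exact integrable_norm_pow_mul_truncPow hn hp₁ hp₂ hp₃ hj hk
  have hm0 := gaussA_mul_integral_truncPow_zero hn hp₁ hp₂ hp₃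
  have hm1 := gaussA_mul_integral_truncPow_one hn hp₁ hp₂ hp₃
  have hm3 := gaussA_mul_integral_truncPow_two hn hp₁ hp₂ hp₃
  rw [← hc, ← hβ, ← ha] at hm0 hm1 hm3
  have hI0 : Integrable (fun v : EuclideanSpace ℝ (Fin n) => truncPow β a ‖v‖) := by
    simpa using hint 0 0 (by norm_num) (by norm_num)
  have hI11 := hint 1 1 (by norm_num) (by norm_num)
  have hI12 := hint 1 2 (by norm_num) (by norm_num)
  have hI22 := hint 2 2 (by norm_num) (by norm_num)
  have hI23 := hint 2 3 (by norm_num) (by norm_num)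
  have hI24 := hint 2 4 (by norm_num) (by norm_num)
  simp only [Nat.cast_one, Nat.cast_ofNat] at hI11 hI12 hI22 hI23 hI24
  set g₁ : ℝ → ℝ := truncPow β (a - 1) with hg₁
  set g₂ : ℝ → ℝ := truncPow β (a - 2) with hg₂
  have mg₁ : Measurable g₁ := measurable_truncPow _ _
  have mg₂ : Measurable g₂ := measurable_truncPow _ _
  have hdiv₁ : ∀ r, truncPow β a r / (1 + β * r ^ 2) = g₁ r := truncPow_div β a
  have hdiv₂ : ∀ r, g₁ r / (1 + β * r ^ 2) = g₂ r := fun r => by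
    rw [hg₁, hg₂, truncPow_div]
    congr 1
    ring
  have hmul₂ : ∀ r, g₁ r = g₂ r + β * r ^ 2 * g₂ r := fun r => by
    by_cases h : 1 + β * r ^ 2 = 0
    · simp [hg₁, hg₂, truncPow, h]
    · rw [← hdiv₂]
      field_simp
  have hm2 : gaussA n p * ∫ v : EuclideanSpace ℝ (Fin n), ‖v‖ ^ 2 * g₂ ‖v‖ =
      n * c * (2 + n * (p - 1)) / (4 * (2 - p)) := by
    have : ∫ v : EuclideanSpace ℝ (Fin n), ‖v‖ ^ 2 * g₁ ‖v‖ =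
        (∫ v : EuclideanSpace ℝ (Fin n), ‖v‖ ^ 2 * g₂ ‖v‖) +
          β * ∫ v : EuclideanSpace ℝ (Fin n), ‖v‖ ^ 4 * g₂ ‖v‖ := by
      rw [← integral_const_mul, ← integral_add hI22 (hI24.const_mul β)]
      congr 1 with v
      rw [hmul₂]
      ring
    rw [this, mul_add] at hm1
    have h2 : gaussA n p * ∫ v : EuclideanSpace ℝ (Fin n), ‖v‖ ^ 2 * g₂ ‖v‖ =
        n * c / 2 - β * (n * (n + 2) * c ^ 2 / (4 * (2 - p))) := by
      rw [← hm3]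
      linarith
    rw [h2, hβ]
    field_simp
    ring
  obtain ⟨CX, hCX0, hCX⟩ := exists_abs_dotProduct_mulVec_le X
  obtain ⟨CY, hCY0, hCY⟩ := exists_abs_dotProduct_mulVec_le Y
  have cX := continuous_dotProduct_mulVec X
  have cY := continuous_dotProduct_mulVec Y
  have exy := integral_inner_mul_inner hn mg₂ hI22 x y
  set qX : EuclideanSpace ℝ (Fin n) → ℝ := fun v => v.ofLp ⬝ᵥ X *ᵥ v.ofLp with hqX
  set qY : EuclideanSpace ℝ (Fin n) → ℝ := fun v => v.ofLp ⬝ᵥ Y *ᵥ v.ofLp with hqY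
  have eX : ∫ v, qX v * g₁ ‖v‖ = _ := integral_dotProduct_mulVec hn mg₁ hI12 X
  have eY : ∫ v, qY v * g₁ ‖v‖ = _ := integral_dotProduct_mulVec hn mg₁ hI12 Y
  have eXY : ∫ v, qX v * qY v * g₂ ‖v‖ = _ :=
    integral_dotProduct_mulVec_mul hn mg₂ hI24 X Y hY
  have nX : ∀ v, qX (-v) = qX v := fun v => by simp [hqX, mulVec_neg]
  have nY : ∀ v, qY (-v) = qY v := fun v => by simp [hqY, mulVec_neg]
  have iX : Integrable (fun v => qX v * g₁ ‖v‖) := integrable_mul_radial mg₁ hI12 cX hCX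
  have iY : Integrable (fun v => qY v * g₁ ‖v‖) := integrable_mul_radial mg₁ hI12 cY hCY
  have iXY : Integrable (fun v => qX v * qY v * g₂ ‖v‖) := by
    refine integrable_mul_radial mg₂ hI24 (cX.mul cY) (C := CX * CY) fun v => ?_
    rw [abs_mul]
    calc _ ≤ (CX * ‖v‖ ^ 2) * (CY * ‖v‖ ^ 2) :=
          mul_le_mul (hCX v) (hCY v) (abs_nonneg _) (by positivity)
      _ = _ := by ring
  have ixy := integrable_inner_mul_inner mg₂ hI22 x y
  have ilin : ∀ w : EuclideanSpace ℝ (Fin n), Integrable (fun v => inner ℝ w v * g₁ ‖v‖) :=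
    fun w => by
      simpa using integrable_inner_pow mg₁ hI11 w
  have icub : ∀ (q : EuclideanSpace ℝ (Fin n) → ℝ) (C : ℝ), 0 ≤ C → Continuous q →
      (∀ v, |q v| ≤ C * ‖v‖ ^ 2) → ∀ w : EuclideanSpace ℝ (Fin n),
      Integrable (fun v => q v * inner ℝ w v * g₂ ‖v‖) := fun q C hC0 hq hC w => by
    refine integrable_mul_radial mg₂ hI23 (hq.mul (by fun_prop)) (C := C * ‖w‖) fun v => ?_
    rw [abs_mul]
    calc _ ≤ (C * ‖v‖ ^ 2) * (‖w‖ * ‖v‖) :=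
          mul_le_mul (hC v) (abs_real_inner_le_norm w v) (abs_nonneg _) (by positivity)
      _ = _ := by ring
  have iXy := icub qX CX hCX0 cX hCX y
  have iYx := icub qY CY hCY0 cY hCY x
  have zlin : ∀ w : EuclideanSpace ℝ (Fin n), ∫ v, inner ℝ w v * g₁ ‖v‖ = 0 := fun w =>
    integral_odd_mul_radial g₁ (by simp)
  have zXy : ∫ v, qX v * inner ℝ y v * g₂ ‖v‖ = 0 :=
    integral_odd_mul_radial g₂ (by simp [nX])
  have zYx : ∫ v, qY v * inner ℝ x v * g₂ ‖v‖ = 0 :=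
    integral_odd_mul_radial g₂ (by simp [nY])
  have hexpand : ∀ v : EuclideanSpace ℝ (Fin n), truncPow β a ‖v‖ *
      (X.trace / 2 - (qX v - 2 * inner ℝ x v) / (1 + β * ‖v‖ ^ 2) / c) *
      (Y.trace / 2 - (qY v - 2 * inner ℝ y v) / (1 + β * ‖v‖ ^ 2) / c) =
      X.trace * Y.trace / 4 * truncPow β a ‖v‖ +
      -Y.trace / (2 * c) * (qX v * g₁ ‖v‖) +
      -X.trace / (2 * c) * (qY v * g₁ ‖v‖) +
      1 / c ^ 2 * (qX v * qY v * g₂ ‖v‖) +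
      4 / c ^ 2 * (inner ℝ x v * inner ℝ y v * g₂ ‖v‖) +
      X.trace / c * (inner ℝ y v * g₁ ‖v‖) +
      Y.trace / c * (inner ℝ x v * g₁ ‖v‖) +
      -2 / c ^ 2 * (qX v * inner ℝ y v * g₂ ‖v‖) +
      -2 / c ^ 2 * (qY v * inner ℝ x v * g₂ ‖v‖) := fun v => by
    rw [← hdiv₂, ← hdiv₁]
    simp only [div_eq_mul_inv]
    ring
  have j₁ := (hI0.const_mul (X.trace * Y.trace / 4)).add (iX.const_mul (-Y.trace / (2 * c)))
  have j₂ := j₁.add (iY.const_mul (-X.trace / (2 * c)))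
  have j₃ := j₂.add (iXY.const_mul (1 / c ^ 2))
  have j₄ := j₃.add (ixy.const_mul (4 / c ^ 2))
  have j₅ := j₄.add ((ilin y).const_mul (X.trace / c))
  have j₆ := j₅.add ((ilin x).const_mul (Y.trace / c))
  have j₇ := j₆.add (iXy.const_mul (-2 / c ^ 2))
  have hsum := integral_add' j₇ (iYx.const_mul (-2 / c ^ 2))
  rw [integral_add' j₆ (iXy.const_mul _), integral_add' j₅ ((ilin x).const_mul _),
    integral_add' j₄ ((ilin y).const_mul _), integral_add' j₃ (ixy.const_mul _),
    integral_add' j₂ (iXY.const_mul _), integral_add' j₁ (iY.const_mul _),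
    integral_add' (hI0.const_mul _) (iX.const_mul _)] at hsum
  refine (congrArg (gaussA n p * ·)
    ((integral_congr_ae (Filter.Eventually.of_forall hexpand)).trans hsum)).trans ?_
  simp only [integral_const_mul, zlin, zXy, zYx, eX, eY, eXY, exy, mul_zero, add_zero]
  rw [mul_comm, ← eq_div_iff hA] at hm0 hm1 hm2 hm3
  rw [hm0, hm1, hm2, hm3]
  field_simp
  ring

lemma hasDerivAt_det_add_smul {n : ℕ} {D : Matrix (Fin n) (Fin n) ℝ} (hD : IsUnit D.det)
    (X : Matrix (Fin n) (Fin n) ℝ) :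
    HasDerivAt (fun t : ℝ => (D + t • X).det) (D.det * (D⁻¹ * X).trace) 0 := by
  set P : Polynomial ℝ :=
    ((1 : Matrix (Fin n) (Fin n) (Polynomial ℝ)) +
      (Polynomial.X : Polynomial ℝ) • (D⁻¹ * X).map Polynomial.C).det.divX.divX with hP
  have heq : (fun t : ℝ => (D + t • X).det) =
      fun t => D.det * (1 + (D⁻¹ * X).trace * t + P.eval t * t ^ 2) := by
    ext t
    rw [← det_one_add_smul, ← det_mul, mul_add, mul_one, Matrix.mul_smul,
      mul_nonsing_inv_cancel_left _ _ hD]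
  rw [heq]
  have h1 := (((hasDerivAt_id (0 : ℝ)).const_mul (D⁻¹ * X).trace).const_add 1).add
    ((P.hasDerivAt 0).mul (hasDerivAt_pow 2 (0 : ℝ)))
  exact (h1.const_mul D.det).congr_deriv (by simp)

lemma hasDerivAt_quadratic_form {n : ℕ} {D X : Matrix (Fin n) (Fin n) ℝ} (hD : D.IsSymm)
    (w x : Fin n → ℝ) :
    HasDerivAt (fun t : ℝ => (w - t • x) ⬝ᵥ (D + t • X) *ᵥ (w - t • x))
      (w ⬝ᵥ X *ᵥ w - 2 * (x ⬝ᵥ D *ᵥ w)) 0 := by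
  have hsymm : w ⬝ᵥ D *ᵥ x = x ⬝ᵥ D *ᵥ w := by
    rw [dotProduct_mulVec, ← mulVec_transpose, hD.eq, dotProduct_comm]
  have heq : (fun t : ℝ => (w - t • x) ⬝ᵥ (D + t • X) *ᵥ (w - t • x)) = fun t =>
      w ⬝ᵥ D *ᵥ w + (w ⬝ᵥ X *ᵥ w - 2 * (x ⬝ᵥ D *ᵥ w)) * t +
        (x ⬝ᵥ D *ᵥ x - w ⬝ᵥ X *ᵥ x - x ⬝ᵥ X *ᵥ w + x ⬝ᵥ X *ᵥ x * t) * t ^ 2 := by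
    ext t
    simp only [add_mulVec, mulVec_sub, mulVec_smul, smul_mulVec, dotProduct_add, dotProduct_sub,
      dotProduct_smul, sub_dotProduct, smul_dotProduct, smul_eq_mul, hsymm]
    ring
  rw [heq]
  have h1 := (((hasDerivAt_id (0 : ℝ)).const_mul (w ⬝ᵥ X *ᵥ w - 2 * (x ⬝ᵥ D *ᵥ w))).const_add
    (w ⬝ᵥ D *ᵥ w)).add ((((hasDerivAt_id (0 : ℝ)).const_mul (x ⬝ᵥ X *ᵥ x)).const_add
      (x ⬝ᵥ D *ᵥ x - w ⬝ᵥ X *ᵥ x - x ⬝ᵥ X *ᵥ w)).mul (hasDerivAt_pow 2 (0 : ℝ)))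
  exact h1.congr_deriv (by simp)

/-- The score of the `p`-Gaussian family. -/
lemma deriv_log_gaussF {n : ℕ} {p : ℝ} (hp₁ : (n : ℝ) / (n + 2) < p) (hp₃ : p ≠ 1)
    {D : Matrix (Fin n) (Fin n) ℝ} (hD : D.PosDef) (X : Matrix (Fin n) (Fin n) ℝ)
    (u x z : Fin n → ℝ)
    (hW : 0 < 1 + (1 - p) / (2 * p - n * (1 - p)) * ((z - u) ⬝ᵥ D *ᵥ (z - u))) :
    deriv (fun t : ℝ => Real.log (gaussF n p (D + t • X) (u + t • x) z)) 0 =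
      (D⁻¹ * X).trace / 2 - ((z - u) ⬝ᵥ X *ᵥ (z - u) - 2 * (x ⬝ᵥ D *ᵥ (z - u))) /
        (1 + (1 - p) / (2 * p - n * (1 - p)) * ((z - u) ⬝ᵥ D *ᵥ (z - u))) /
        (2 * p - n * (1 - p)) := by
  have hc := gaussA_denominator_pos hp₁
  have hA := gaussA_pos_s10 hp₁ hp₃
  have hp' : p - 1 ≠ 0 := sub_ne_zero.2 hp₃
  set β := (1 - p) / (2 * p - n * (1 - p)) with hβ
  have hdet : 0 < D.det := hD.det_pos
  have hsymm : D.IsSymm := by simpa using hD.isHermitian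
  have hd := hasDerivAt_det_add_smul (isUnit_iff_ne_zero.2 hdet.ne') X
  have hq := ((hasDerivAt_quadratic_form hsymm (X := X) (z - u) x).const_mul β).const_add 1
  have hsub : ∀ t : ℝ, z - (u + t • x) = z - u - t • x := fun t => sub_add_eq_sub_sub _ _ _
  have hW0 : 0 < 1 + β * ((z - u - (0 : ℝ) • x) ⬝ᵥ (D + (0 : ℝ) • X) *ᵥ
      (z - u - (0 : ℝ) • x)) := by simpa using hW
  have hd0 : 0 < (D + (0 : ℝ) • X).det := by simpa using hdet
  have hev : (fun t : ℝ => Real.log (gaussF n p (D + t • X) (u + t • x) z)) =ᶠ[nhds 0]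
      fun t => Real.log (gaussA n p) + Real.log (D + t • X).det / 2 + 1 / (p - 1) *
        Real.log (1 + β * ((z - u - t • x) ⬝ᵥ (D + t • X) *ᵥ (z - u - t • x))) := by
    filter_upwards [hd.continuousAt.eventually (lt_mem_nhds hd0),
      hq.continuousAt.eventually (lt_mem_nhds hW0)] with t ht1 ht2
    have hs := Real.sqrt_pos.2 ht1
    rw [gaussF, hsub, ← hβ, if_pos ht2.le, Real.log_mul (by positivity) (by positivity),
      Real.log_mul (by positivity) (by positivity), Real.log_sqrt ht1.le, Real.log_rpow ht2]
  rw [hev.deriv_eq]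
  have h := (((hd.log hd0.ne').div_const 2).const_add (Real.log (gaussA n p))).add
    ((hq.log hW0.ne').const_mul (1 / (p - 1)))
  refine (h.congr_deriv ?_).deriv
  simp only [zero_smul, add_zero, sub_zero, mul_div_cancel_left₀ _ hdet.ne']
  rw [sub_eq_add_neg ((D⁻¹ * X).trace / 2)]
  congr 1
  generalize 1 + β * ((z - u) ⬝ᵥ D *ᵥ (z - u)) = W at hW ⊢
  rw [hβ]
  generalize 2 * p - n * (1 - p) = c at hc ⊢
  field_simp
  ring

lemma gaussF_eq_ite {n : ℕ} {p : ℝ} (hp₃ : p ≠ 1) (D : Matrix (Fin n) (Fin n) ℝ)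
    (u z : Fin n → ℝ) :
    gaussF n p D u z =
      if 0 < 1 + (1 - p) / (2 * p - n * (1 - p)) * ((z - u) ⬝ᵥ D *ᵥ (z - u)) then
        gaussA n p * √D.det *
          (1 + (1 - p) / (2 * p - n * (1 - p)) * ((z - u) ⬝ᵥ D *ᵥ (z - u))) ^ (1 / (p - 1))
      else 0 := by
  have hp' : 1 / (p - 1) ≠ 0 := one_div_ne_zero (sub_ne_zero.2 hp₃)
  unfold gaussF
  rcases lt_trichotomy 0 (1 + (1 - p) / (2 * p - n * (1 - p)) * ((z - u) ⬝ᵥ D *ᵥ (z - u)))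
    with h | h | h
  · rw [if_pos h.le, if_pos h]
  · rw [← h, if_pos le_rfl, if_neg (lt_irrefl _), Real.zero_rpow hp', mul_zero]
  · rw [if_neg h.not_ge, if_neg h.not_gt]

lemma exists_eq_transpose_mul_self {n : ℕ} {D : Matrix (Fin n) (Fin n) ℝ} (hD : D.PosDef) :
    ∃ B : Matrix (Fin n) (Fin n) ℝ, D = Bᵀ * B ∧ B.det ≠ 0 := by
  obtain ⟨B, hB⟩ := by
    open scoped MatrixOrder in
    exact CStarAlgebra.nonneg_iff_eq_star_mul_self.mp hD.posSemidef.nonneg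
  rw [star_eq_conjTranspose, conjTranspose_eq_transpose_of_trivial] at hB
  refine ⟨B, hB, fun h => hD.det_pos.ne' ?_⟩
  rw [hB, det_mul, h, mul_zero]

/-- Linear change of variables from `ℝⁿ` to Euclidean coordinates. -/
lemma integral_comp_mulVec_sub {n : ℕ} {B : Matrix (Fin n) (Fin n) ℝ} (hB : B.det ≠ 0)
    (u : Fin n → ℝ) (H : EuclideanSpace ℝ (Fin n) → ℝ) :
    ∫ z : Fin n → ℝ, H (WithLp.toLp 2 (B *ᵥ (z - u))) =
      |B.det|⁻¹ * ∫ v : EuclideanSpace ℝ (Fin n), H v := by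
  rw [integral_sub_right_eq_self (fun z => H (WithLp.toLp 2 (B *ᵥ z))) u]
  have hinv : IsUnit B := (isUnit_iff_isUnit_det B).2 (isUnit_iff_ne_zero.2 hB)
  have hemb : MeasurableEmbedding (toLin' B) :=
    (LinearMap.continuous_of_finiteDimensional _).measurableEmbedding
      fun a b h => mulVec_injective_iff_isUnit.2 hinv (by simpa using h)
  have h1 := hemb.integral_map (μ := volume) (fun v => H (WithLp.toLp 2 v))
  rw [Real.map_matrix_volume_pi_eq_smul_volume_pi hB, integral_smul_measure] at h1
  simp only [toLin'_apply] at h1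
  rw [← h1, ENNReal.toReal_ofReal (abs_nonneg _), abs_inv, smul_eq_mul,
    (PiLp.volume_preserving_toLp (Fin n)).integral_comp
      (MeasurableEquiv.toLp 2 (Fin n → ℝ)).measurableEmbedding]

lemma dotProduct_transpose_mul_mulVec {n : ℕ} (B M : Matrix (Fin n) (Fin n) ℝ)
    (v w : Fin n → ℝ) : v ⬝ᵥ (Bᵀ * M) *ᵥ w = (B *ᵥ v) ⬝ᵥ M *ᵥ w := by
  rw [← mulVec_mulVec, dotProduct_mulVec, vecMul_transpose]

/-- the Fisher information matrix of the family of `p`-Gaussian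
distributions, for `n/(n+2) < p < 2`, `p ≠ 1`. -/
theorem fisher_gaussF (n : ℕ) (hn : 1 ≤ n) (p : ℝ)
    (hp₁ : (n : ℝ) / (n + 2) < p) (hp₂ : p < 2) (hp₃ : p ≠ 1)
    (D : Matrix (Fin n) (Fin n) ℝ) (hD : D.PosDef) (u : Fin n → ℝ)
    (X Y : Matrix (Fin n) (Fin n) ℝ) (hX : X.IsSymm) (hY : Y.IsSymm)
    (x y : Fin n → ℝ) :
    (∫ z : Fin n → ℝ,
        if gaussF n p D u z = 0 then 0 else
          gaussF n p D u z *
            deriv (fun t : ℝ => Real.log (gaussF n p (D + t • X) (u + t • x) z)) 0 *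
            deriv (fun s : ℝ => Real.log (gaussF n p (D + s • Y) (u + s • y) z)) 0) =
      1 / (2 * (2 - p)) * (D⁻¹ * X * D⁻¹ * Y).trace +
        (p - 1) / (4 * (2 - p)) * (D⁻¹ * X).trace * (D⁻¹ * Y).trace +
        (2 + n * (p - 1)) / ((2 * p + n * (p - 1)) * (2 - p)) * (x ⬝ᵥ D.mulVec y) := by
  obtain ⟨B, hDB, hB⟩ := exists_eq_transpose_mul_self hD
  have hBu : IsUnit B.det := isUnit_iff_ne_zero.2 hB
  have hA := gaussA_pos_s10 hp₁ hp₃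
  have hdet : √D.det = |B.det| := by
    rw [hDB, det_mul, det_transpose, Real.sqrt_mul_self_eq_abs]
  have hinv : D⁻¹ = B⁻¹ * (B⁻¹)ᵀ := by rw [hDB, Matrix.mul_inv_rev, transpose_nonsing_inv]
  have htrace : ∀ Z : Matrix (Fin n) (Fin n) ℝ,
      (D⁻¹ * Z).trace = ((B⁻¹)ᵀ * Z * B⁻¹).trace := fun Z => by
    rw [hinv, Matrix.mul_assoc, trace_mul_comm]
  have htrace₂ : (D⁻¹ * X * D⁻¹ * Y).trace =
      ((B⁻¹)ᵀ * X * B⁻¹ * ((B⁻¹)ᵀ * Y * B⁻¹)).trace := by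
    rw [Matrix.mul_assoc, Matrix.mul_assoc, htrace, hinv]
    simp only [Matrix.mul_assoc]
  have hquad : ∀ (Z : Matrix (Fin n) (Fin n) ℝ) (w : Fin n → ℝ),
      (B *ᵥ w) ⬝ᵥ ((B⁻¹)ᵀ * Z * B⁻¹) *ᵥ (B *ᵥ w) = w ⬝ᵥ Z *ᵥ w := fun Z w => by
    rw [Matrix.mul_assoc, dotProduct_transpose_mul_mulVec, ← mulVec_mulVec, mulVec_mulVec w B⁻¹ B,
      mulVec_mulVec, nonsing_inv_mul _ hBu, Matrix.mul_one, one_mulVec]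
  have hbil : ∀ v w : Fin n → ℝ, inner ℝ (WithLp.toLp 2 (B *ᵥ v)) (WithLp.toLp 2 (B *ᵥ w)) =
      v ⬝ᵥ D *ᵥ w := fun v w => by
    rw [hDB, dotProduct_transpose_mul_mulVec, EuclideanSpace.inner_toLp_toLp, star_trivial,
      dotProduct_comm]
  have hnorm : ∀ w : Fin n → ℝ, ‖WithLp.toLp 2 (B *ᵥ w)‖ ^ 2 = w ⬝ᵥ D *ᵥ w := fun w => by
    rw [← real_inner_self_eq_norm_sq, hbil]
  have hYB : ((B⁻¹)ᵀ * Y * B⁻¹).IsSymm := by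
    simp [Matrix.IsSymm, transpose_mul, Matrix.mul_assoc, hY.eq]
  have hstd := fisher_standard hn hp₁ hp₂ hp₃ ((B⁻¹)ᵀ * X * B⁻¹) ((B⁻¹)ᵀ * Y * B⁻¹) hYB
    (WithLp.toLp 2 (B *ᵥ x)) (WithLp.toLp 2 (B *ᵥ y)) rfl rfl rfl
  rw [hbil, ← htrace₂, ← htrace, ← htrace] at hstd
  rw [show 2 * p + (n : ℝ) * (p - 1) = 2 * p - n * (1 - p) by ring, ← hstd]
  have hchange : ∀ H : EuclideanSpace ℝ (Fin n) → ℝ, gaussA n p * ∫ v, H v =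
      ∫ z : Fin n → ℝ, gaussA n p * |B.det| * H (WithLp.toLp 2 (B *ᵥ (z - u))) := fun H => by
    rw [integral_const_mul, integral_comp_mulVec_sub hB u H, mul_assoc,
      mul_inv_cancel_left₀ (abs_ne_zero.2 hB)]
  rw [hchange]
  congr 1 with z
  simp only [hquad, hbil, hnorm, truncPow]
  rw [gaussF_eq_ite hp₃]
  by_cases hW : 0 < 1 + (1 - p) / (2 * p - n * (1 - p)) * ((z - u) ⬝ᵥ D *ᵥ (z - u))
  · have hB' := abs_pos.2 hB
    rw [if_pos hW, if_pos hW, deriv_log_gaussF hp₁ hp₃ hD X u x z hW,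
      deriv_log_gaussF hp₁ hp₃ hD Y u y z hW, hdet, if_neg (by positivity)]
    ring
  · rw [if_neg hW, if_neg hW]
    simp
end
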